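/- The finite subgroups of ℍ^× are, up to conjugacy: cyclic groups C_d (d ≥ 1), binary dihedral groups of order 4d (d ≥ 2), and the binary tetrahedral, binary octahedral, and binary icosahedral groups of orders 24, 48, 120. -/

import Mathlib

noncomputable section

abbrev Hq := Quaternion ℝ

/-- The subgroup of `ℍ^×` generated by a set of (nonzero) quaternions. -/
def genQ (S : Set Hq) : Subgroup Hqˣ := Subgroup.closure {u : Hqˣ | (u : Hq) ∈ S}

/-- The complex root of unity `e^{2πi/d}` inside `ℍ`. -/
def ζq (d : ℕ) : Hq := ⟨Real.cos (2 * Real.pi / d), Real.sin (2 * Real.pi / d), 0, 0⟩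

def iq : Hq := ⟨0, 1, 0, 0⟩
def jq : Hq := ⟨0, 0, 1, 0⟩
/-- `ω = (1 + i + j + k)/2`. -/
def ωq : Hq := ⟨1/2, 1/2, 1/2, 1/2⟩
/-- `(1 + i)/√2`. -/
def sqq : Hq := ⟨Real.sqrt 2 / 2, Real.sqrt 2 / 2, 0, 0⟩
/-- The golden ratio. -/
def φg : ℝ := (1 + Real.sqrt 5) / 2
/-- `τ = (φ + φ⁻¹ i + j)/2`, an element of order 10 of the binary icosahedral group. -/
def τq : Hq := ⟨φg / 2, (φg - 1) / 2, 1 / 2, 0⟩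

/-- The cyclic group `C_d ≤ ℍ^×`. -/
def cycQ (d : ℕ) : Subgroup Hqˣ := genQ {ζq d}
/-- The binary dihedral group `D_d ≤ ℍ^×` of order `4d`. -/
def binDihQ (d : ℕ) : Subgroup Hqˣ := genQ {ζq (2 * d), jq}
/-- The binary tetrahedral group, of order 24. -/
def binTetQ : Subgroup Hqˣ := genQ {iq, jq, ωq}
/-- The binary octahedral group, of order 48. -/
def binOctQ : Subgroup Hqˣ := genQ {iq, jq, ωq, sqq}
/-- The binary icosahedral group, of order 120. -/
def binIcoQ : Subgroup Hqˣ := genQ {ωq, τq}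

/-- The quaternion `a + bi + cj + dk`. -/
def mkQ (a b c d : ℝ) : Hq := ⟨a, b, c, d⟩

@[simp] lemma mkQ_re (a b c d : ℝ) : (mkQ a b c d).re = a := rfl
@[simp] lemma mkQ_imI (a b c d : ℝ) : (mkQ a b c d).imI = b := rfl
@[simp] lemma mkQ_imJ (a b c d : ℝ) : (mkQ a b c d).imJ = c := rfl
@[simp] lemma mkQ_imK (a b c d : ℝ) : (mkQ a b c d).imK = d := rfl

lemma iq_eq_mkQ : iq = mkQ 0 1 0 0 := rfl

lemma jq_eq_mkQ : jq = mkQ 0 0 1 0 := rfl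

lemma ωq_eq_mkQ : ωq = mkQ (1 / 2) (1 / 2) (1 / 2) (1 / 2) := rfl

lemma sqq_eq_mkQ : sqq = mkQ (√2 / 2) (√2 / 2) 0 0 := rfl

lemma τq_eq_mkQ : τq = mkQ (φg / 2) ((φg - 1) / 2) (1 / 2) 0 := rfl

lemma ζq_eq_mkQ (d : ℕ) :
    ζq d = mkQ (Real.cos (2 * Real.pi / d)) (Real.sin (2 * Real.pi / d)) 0 0 := rfl

open Quaternion in
lemma quaternion_sq_eq (g : Hq) : g * g = (2 * g.re) • g - ((normSq g : ℝ) : Hq) := by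
  have h := normSq_def' g
  generalize normSq g = n at h ⊢
  ext <;> simp <;> linarith

open Quaternion in
lemma re_eq_zero_of_mul_self {p : Hq} (hp : p * p = -1) : p.re = 0 := by
  have h0 := congrArg QuaternionAlgebra.re hp
  have h1 := congrArg QuaternionAlgebra.imI hp
  have h2 := congrArg QuaternionAlgebra.imJ hp
  have h3 := congrArg QuaternionAlgebra.imK hp
  simp at h0 h1 h2 h3
  by_contra ha
  have e1 : p.imI = 0 := by
    have : p.re * p.imI = 0 := by linarith
    exact (mul_eq_zero.1 this).resolve_left ha
  have e2 : p.imJ = 0 := by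
    have : p.re * p.imJ = 0 := by linarith
    exact (mul_eq_zero.1 this).resolve_left ha
  have e3 : p.imK = 0 := by
    have : p.re * p.imK = 0 := by linarith
    exact (mul_eq_zero.1 this).resolve_left ha
  rw [e1, e2, e3] at h0
  nlinarith [sq_nonneg p.re]

open Quaternion in
lemma normSq_eq_one_of_mul_self {p : Hq} (hp : p * p = -1) : normSq p = 1 := by
  have h0 := congrArg QuaternionAlgebra.re hp
  have := re_eq_zero_of_mul_self hp
  simp [this] at h0
  rw [normSq_def', this]
  linarith

lemma ne_zero_of_mul_self {p : Hq} (hp : p * p = -1) : p ≠ 0 := by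
  rintro rfl
  simp at hp

lemma eq_or_eq_neg_of_commute {p q : Hq} (hp : p * p = -1) (hq : q * q = -1)
    (h : Commute p q) : q = p ∨ q = -p := by
  have h' : p * q = q * p := h
  have : (q - p) * (q + p) = 0 := by
    rw [sub_mul, mul_add, mul_add, hp, hq, h']
    abel
  rcases mul_eq_zero.1 this with h1 | h1
  · exact Or.inl (sub_eq_zero.1 h1)
  · exact Or.inr (eq_neg_of_add_eq_zero_left h1)

open Quaternion in
/-- A unit quaternion other than `±1` lies on a unique axis. -/
lemma exists_axis {g : Hq} (hg : normSq g = 1) (h1 : g ≠ 1) (h2 : g ≠ -1) :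
    ∃ (p : Hq) (r : ℝ), p * p = -1 ∧ 0 < r ∧ g = (g.re : Hq) + (r : Hq) * p := by
  set N : ℝ := g.imI ^ 2 + g.imJ ^ 2 + g.imK ^ 2 with hN
  rw [normSq_def'] at hg
  have hN0 : 0 < N := by
    rcases (show 0 ≤ N by positivity).eq_or_lt with h | h
    · exfalso
      have e1 : g.imI = 0 := by nlinarith [sq_nonneg g.imI, sq_nonneg g.imJ, sq_nonneg g.imK]
      have e2 : g.imJ = 0 := by nlinarith [sq_nonneg g.imI, sq_nonneg g.imJ, sq_nonneg g.imK]
      have e3 : g.imK = 0 := by nlinarith [sq_nonneg g.imI, sq_nonneg g.imJ, sq_nonneg g.imK]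
      have : (g.re - 1) * (g.re + 1) = 0 := by linarith
      rcases mul_eq_zero.1 this with h | h
      · apply h1; ext <;> simp [e1, e2, e3]; linarith
      · apply h2; ext <;> simp [e1, e2, e3]; linarith
    · exact h
  set r : ℝ := Real.sqrt N with hr
  have hr0 : 0 < r := Real.sqrt_pos.2 hN0
  have hrr : r ^ 2 = N := Real.sq_sqrt hN0.le
  let p : Hq := r⁻¹ • g.im
  have hgp : g = (g.re : Hq) + (r : Hq) * p := by
    ext <;> simp [p] <;> field_simp
  refine ⟨p, r, ?_, hr0, hgp⟩
  ext
  · simp [p]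
    field_simp
    rw [hrr, hN]
    ring
  all_goals
    simp [p]
    ring_nf
    simp

open Quaternion in
lemma commute_iff_of_eq_add {g p : Hq} {a r : ℝ} (hr : 0 < r) (h : g = (a : Hq) + (r : Hq) * p)
    (x : Hq) : Commute x g ↔ Commute x p := by
  have hpg : p = ((r⁻¹ : ℝ) : Hq) * (g - (a : Hq)) := by
    rw [h, add_sub_cancel_left, ← mul_assoc, ← coe_mul, inv_mul_cancel₀ hr.ne', coe_one, one_mul]
  refine ⟨fun hx => ?_, fun hx => ?_⟩
  · rw [hpg]
    exact ((coe_commute _ x).symm).mul_right (hx.sub_right (coe_commute _ x).symm)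
  · rw [h]
    exact ((coe_commute _ x).symm).add_right (((coe_commute _ x).symm).mul_right hx)

open Quaternion in
lemma normSq_coe_add_coe_mul {p : Hq} (hp : p * p = -1) (a r : ℝ) :
    normSq ((a : Hq) + (r : Hq) * p) = a ^ 2 + r ^ 2 := by
  have h := normSq_eq_one_of_mul_self hp
  rw [normSq_def', re_eq_zero_of_mul_self hp] at h
  rw [normSq_def']
  simp [re_eq_zero_of_mul_self hp]
  linear_combination r ^ 2 * h

lemma mul_self_conj {p : Hq} (hp : p * p = -1) (u : Hqˣ) :
    ((u : Hq) * p * ↑u⁻¹) * ((u : Hq) * p * ↑u⁻¹) = -1 := by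
  have : ((u : Hq) * p * ↑u⁻¹) * ((u : Hq) * p * ↑u⁻¹) = u * (p * p) * ↑u⁻¹ := by
    simp [mul_assoc]
  rw [this, hp]
  simp

open Quaternion in
lemma exists_orthogonal {p : Hq} (hp : p * p = -1) : ∃ u : Hqˣ, (u : Hq) * p = -p * u := by
  have hre := re_eq_zero_of_mul_self hp
  by_cases h : p.imI = 0 ∧ p.imJ = 0
  · have hne : iq ≠ 0 := fun h => by simpa [iq_eq_mkQ] using congrArg QuaternionAlgebra.imI h
    refine ⟨Units.mk0 iq hne, ?_⟩
    rw [Units.val_mk0]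
    ext <;> simp [iq_eq_mkQ, hre, h.1, h.2]
  · have hne : mkQ 0 (-p.imJ) p.imI 0 ≠ 0 := fun h' => h
      ⟨by simpa using congrArg QuaternionAlgebra.imJ h',
        by simpa using congrArg QuaternionAlgebra.imI h'⟩
    refine ⟨Units.mk0 _ hne, ?_⟩
    rw [Units.val_mk0]
    ext <;> simp [hre] <;> ring

open Quaternion in
lemma exists_conj_axis {p q : Hq} (hp : p * p = -1) (hq : q * q = -1) :
    ∃ u : Hqˣ, (u : Hq) * p = q * u := by
  by_cases h : 1 - q * p = 0
  · have : q = -p := by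
      have h' : q * p = 1 := (sub_eq_zero.1 h).symm
      have := congrArg (· * p) h'
      simp only [mul_assoc, hp, one_mul] at this
      rw [← this]; simp
    rw [this]
    exact exists_orthogonal hp
  · refine ⟨Units.mk0 _ h, ?_⟩
    simp only [Units.val_mk0]
    rw [sub_mul, mul_sub, mul_assoc, hp, ← mul_assoc, hq]
    simp [add_comm]

lemma normSq_conj (u : Hqˣ) (g : Hq) :
    Quaternion.normSq ((u : Hq) * g * (↑u⁻¹ : Hq)) = Quaternion.normSq g := by
  have : Quaternion.normSq (u : Hq) ≠ 0 := Quaternion.normSq_ne_zero.2 u.ne_zero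
  rw [map_mul, map_mul, Units.val_inv_eq_inv_val, Quaternion.normSq_inv]
  field_simp

lemma re_conj (u : Hqˣ) (g : Hq) : ((u : Hq) * g * (↑u⁻¹ : Hq)).re = g.re := by
  have h : ∀ x y : Hq, (x * y).re = (y * x).re := fun x y => by simp; ring
  rw [h, ← mul_assoc]
  simp

open Quaternion in
/-- Unit quaternions with the same real part are conjugate. -/
lemma exists_conj {s s' : Hq} (hs : normSq s = 1) (hs' : normSq s' = 1) (hre : s.re = s'.re) :
    ∃ u : Hqˣ, (u : Hq) * s = s' * u := by
  have hreal : ∀ {x : Hq}, normSq x = 1 → ∀ c : ℝ, c ^ 2 = 1 → x.re = c → x = (c : Hq) := by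
    intro x hx c hc h
    rw [normSq_def', h, hc] at hx
    ext
    · simp [h]
    all_goals
      simp
      nlinarith [sq_nonneg x.imI, sq_nonneg x.imJ, sq_nonneg x.imK]
  by_cases h : s = 1 ∨ s' = 1 ∨ s = -1 ∨ s' = -1
  · obtain ⟨c, hc, h1, h2⟩ : ∃ c : ℝ, c ^ 2 = 1 ∧ s.re = c ∧ s'.re = c := by
      rcases h with h | h | h | h
      · exact ⟨1, by norm_num, by simp [h], by simp [← hre, h]⟩
      · exact ⟨1, by norm_num, by simp [hre, h], by simp [h]⟩
      · exact ⟨-1, by norm_num, by simp [h], by simp [← hre, h]⟩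
      · exact ⟨-1, by norm_num, by simp [hre, h], by simp [h]⟩
    exact ⟨1, by rw [hreal hs c hc h1, hreal hs' c hc h2]; simp⟩
  · push Not at h
    obtain ⟨p, r, hp, hr, hg⟩ := exists_axis hs h.1 h.2.2.1
    obtain ⟨q, t, hq, ht, hg'⟩ := exists_axis hs' h.2.1 h.2.2.2
    have e1 := normSq_coe_add_coe_mul hp s.re r
    have e2 := normSq_coe_add_coe_mul hq s'.re t
    rw [← hg] at e1
    rw [← hg', ← hre] at e2
    have hrt : r = t := (pow_left_inj₀ hr.le ht.le two_ne_zero).1 (by linarith)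
    obtain ⟨u, hu⟩ := exists_conj_axis hp hq
    refine ⟨u, ?_⟩
    rw [hg, hg', ← hre, ← hrt, mul_add, add_mul, (coe_commute s.re (u : Hq)).eq, mul_assoc, ← hu,
      ← mul_assoc, ← mul_assoc, (coe_commute r (u : Hq)).eq]

/-- `⟨im s, im t⟩` expressed through traces. -/
def imInner (s t : Hq) : ℝ := s.re * t.re - (s * t).re

open Quaternion in
lemma smul_eq_of_commutator (s t : Hq) :
    (2 * normSq s.im) • t = ((2 * normSq s.im * t.re : ℝ) : Hq) +
      (2 * imInner s t) • s.im - s.im * (s * t - t * s) := by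
  have h := normSq_def' s.im
  simp at h
  generalize normSq s.im = n at h ⊢
  ext <;> simp [imInner] <;> rw [h] <;> ring

open Quaternion in
lemma commutator_mul_self (s t : Hq) :
    (s * t - t * s) * (s * t - t * s) =
      ((4 * (imInner s t ^ 2 - normSq s.im * normSq t.im) : ℝ) : Hq) := by
  have h := normSq_def' s.im
  have h' := normSq_def' t.im
  simp at h h'
  generalize normSq s.im = n at h ⊢
  generalize normSq t.im = m at h' ⊢
  subst h h'
  generalize hr : 4 * (imInner s t ^ 2 - _) = r
  simp [imInner] at hr
  ext <;> simp
  · rw [← hr]; ring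
  all_goals ring

lemma mul_commutator (s t : Hq) : s * (s * t - t * s) = (s * t - t * s) * star s := by
  ext <;> simp <;> ring

lemma star_mul_commutator (s t : Hq) : star s * (s * t - t * s) = (s * t - t * s) * s := by
  ext <;> simp <;> ring

lemma im_mul_commutator (s t : Hq) : s.im * (s * t - t * s) = -((s * t - t * s) * s.im) := by
  ext <;> simp <;> ring

open Quaternion in
lemma normSq_im {x : Hq} (hx : normSq x = 1) : normSq x.im = 1 - x.re ^ 2 := by
  rw [normSq_def'] at hx ⊢
  simp
  linarith

open Quaternion in
lemma exists_conj_pair_aux {s t t' : Hq} (ht : normSq t = 1) (ht' : normSq t' = 1)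
    (hre : t.re = t'.re) (hst : (s * t).re = (s * t').re) (hc : s * t ≠ t * s) :
    ∃ u : Hqˣ, (u : Hq) * s = s * u ∧ (u : Hq) * t = t' * u := by
  have hi : imInner s t = imInner s t' := by simp [imInner, hre, hst]
  have hs0 : normSq s.im ≠ 0 := by
    intro h
    have h := normSq_eq_zero.1 h
    apply hc
    rw [← re_add_im s, h, add_zero, (coe_commute s.re t).eq]
  have hN : normSq t.im = normSq t'.im := by rw [normSq_im ht, normSq_im ht', hre]
  obtain ⟨M, hM⟩ : ∃ M : ℝ, M = -(4 * (imInner s t ^ 2 - normSq s.im * normSq t.im)) := ⟨_, rfl⟩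
  have e := commutator_mul_self s t
  have e' := commutator_mul_self s t'
  rw [← hi, ← hN] at e'
  rw [show 4 * (imInner s t ^ 2 - normSq s.im * normSq t.im) = -M by linarith] at e e'
  have f := smul_eq_of_commutator s t
  have f' := smul_eq_of_commutator s t'
  rw [← hi, ← hre] at f'
  have hstar := star_mul_commutator s t
  have hstar' := mul_commutator s t'
  have him := im_mul_commutator s t
  have hcz : s * t - t * s ≠ 0 := sub_ne_zero.2 hc
  generalize s * t - t * s = c at *
  generalize s * t' - t' * s = c' at *
  have finish : ∀ u : Hq, u * s = s * u → u * c = c' * u → u * t = t' * u := by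
    intro u h1 h2
    have h3 : u * s.im = s.im * u := by
      rw [← sub_re_self, mul_sub, sub_mul, h1, (coe_commute s.re u).eq]
    have h4 : (2 * normSq s.im) • (u * t) = (2 * normSq s.im) • (t' * u) := by
      rw [← mul_smul_comm, ← smul_mul_assoc, f, f', mul_sub, sub_mul, mul_add, add_mul,
        (coe_commute _ u).eq, mul_smul_comm, smul_mul_assoc, h3, ← mul_assoc, h3,
        mul_assoc s.im u c, h2,
        ← mul_assoc s.im c' u]
    exact smul_right_injective _ (mul_ne_zero two_ne_zero hs0) h4
  by_cases h : (M : Hq) - c' * c = 0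
  · have hu : s.im ≠ 0 := by
      rw [← normSq_ne_zero]; exact hs0
    have hcomm : s.im * s = s * s.im := by
      rw [← sub_re_self, mul_sub, sub_mul, (coe_commute s.re s).eq]
    have hM0 : (M : Hq) ≠ 0 := by
      intro h0
      have : c * c = 0 := by rw [e, coe_neg, h0, neg_zero]
      exact hcz (mul_self_eq_zero.1 this)
    have hcc : c' = -c := by
      have h3 : c' * c = M := (sub_eq_zero.1 h).symm
      have h4 := congrArg (· * c) h3
      simp only [mul_assoc, e, coe_neg, mul_neg] at h4
      rw [← (coe_commute M c').eq, neg_eq_iff_eq_neg, ← mul_neg] at h4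
      exact mul_left_cancel₀ hM0 h4
    refine ⟨Units.mk0 _ hu, hcomm, finish _ hcomm ?_⟩
    rw [hcc, neg_mul]
    exact him
  · have hcomm : ((M : Hq) - c' * c) * s = s * ((M : Hq) - c' * c) := by
      rw [sub_mul, mul_sub, (coe_commute M s).eq, mul_assoc, ← hstar, ← mul_assoc, ← hstar',
        mul_assoc]
    refine ⟨Units.mk0 _ h, hcomm, finish _ hcomm ?_⟩
    rw [Units.val_mk0, sub_mul, mul_sub, mul_assoc, e, ← mul_assoc, e', coe_neg, mul_neg, neg_mul,
      sub_neg_eq_add, sub_neg_eq_add, add_comm]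

open Quaternion in
/-- A noncommuting pair of unit quaternions is determined up to conjugacy by its traces. -/
lemma exists_conj_pair {s t s' t' : Hq} (hs : normSq s = 1) (ht : normSq t = 1)
    (hs' : normSq s' = 1) (ht' : normSq t' = 1) (hres : s.re = s'.re) (hret : t.re = t'.re)
    (hst : (s * t).re = (s' * t').re) (hc : s * t ≠ t * s) :
    ∃ u : Hqˣ, (u : Hq) * s = s' * u ∧ (u : Hq) * t = t' * u := by
  obtain ⟨v, hv⟩ := exists_conj hs hs' hres
  have hv' : s' = v * s * (↑v⁻¹ : Hq) := by rw [hv]; simp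
  obtain ⟨w, hw, hw'⟩ := exists_conj_pair_aux (s := s') (t := v * t * (↑v⁻¹ : Hq)) (t' := t')
    (by rw [normSq_conj, ht]) ht' (by rw [re_conj, hret])
    (by
      rw [← hst, hv', ← re_conj v (s * t)]
      simp [mul_assoc])
    (by
      intro h
      apply hc
      have : (v : Hq) * (s * t) * (↑v⁻¹ : Hq) = v * (t * s) * (↑v⁻¹ : Hq) := by
        rw [hv'] at h
        simpa [mul_assoc] using h
      simpa using this)
  refine ⟨w * v, ?_, ?_⟩
  · rw [Units.val_mul, mul_assoc, hv, ← mul_assoc, hw, mul_assoc]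
  · rw [Units.val_mul, ← mul_assoc, ← hw']
    simp [mul_assoc]

open Quaternion in
lemma normSq_eq_one_of_mem {G : Subgroup Hqˣ} [Finite G] {g : Hqˣ} (hg : g ∈ G) :
    normSq (g : Hq) = 1 := by
  have h : g ^ Nat.card G = 1 := by
    exact congrArg Subtype.val (pow_card_eq_one' (x := (⟨g, hg⟩ : G)))
  have h2 : normSq (g : Hq) ^ Nat.card G = 1 := by
    rw [← map_pow, ← Units.val_pow_eq_pow_val, h]
    simp
  exact (pow_eq_one_iff_of_nonneg normSq_nonneg Nat.card_pos.ne').1 h2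

open Quaternion in
lemma val_inv_eq_star {g : Hqˣ} (hg : normSq (g : Hq) = 1) :
    ((g⁻¹ : Hqˣ) : Hq) = star (g : Hq) := by
  rw [Units.val_inv_eq_inv_val]
  apply inv_eq_of_mul_eq_one_right
  rw [self_mul_star, hg, coe_one]

open Quaternion in
lemma re_eq_of_mul_self {g : Hq} (hg : normSq g = 1) {c : ℝ} (h : g * g = c • g - 1) :
    g.re = c / 2 := by
  have h1 := quaternion_sq_eq g
  rw [h, hg, coe_one, sub_left_inj] at h1
  have h0 : g ≠ 0 := by rintro rfl; simp at hg
  have := smul_left_injective ℝ h0 h1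
  linarith

open Quaternion in
lemma eq_one_of_re {g : Hq} (hg : normSq g = 1) (h : g.re = 1) : g = 1 := by
  rw [normSq_def', h] at hg
  ext
  · simp [h]
  all_goals
    simp
    nlinarith [sq_nonneg g.imI, sq_nonneg g.imJ, sq_nonneg g.imK]

open Quaternion in
lemma re_le_one {g : Hq} (hg : normSq g = 1) : g.re ≤ 1 := by
  rw [normSq_def'] at hg
  nlinarith [sq_nonneg g.imI, sq_nonneg g.imJ, sq_nonneg g.imK, sq_nonneg (g.re - 1)]

lemma eq_or_eq_neg_of_sq {g : Hq} (h : g ^ 2 = 1) : g = 1 ∨ g = -1 := by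
  have : (g - 1) * (g + 1) = 0 := by
    have : (g - 1) * (g + 1) = g ^ 2 - 1 := by noncomm_ring
    rw [this, h, sub_self]
  rcases mul_eq_zero.1 this with h | h
  · exact Or.inl (sub_eq_zero.1 h)
  · exact Or.inr (eq_neg_of_add_eq_zero_left h)

lemma quadratic_mul_quadratic (x : Hq) (r s : ℝ) :
    (x * x - r • x + 1) * (x * x - s • x + 1) =
      x ^ 4 - (r + s) • x ^ 3 + (2 + r * s) • x ^ 2 - (r + s) • x + 1 := by
  simp only [mul_add, add_mul, mul_sub, sub_mul, smul_mul_assoc, mul_smul_comm, one_mul, mul_one,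
    pow_succ, pow_zero, mul_assoc]
  module

open Quaternion in
lemma re_of_pow_four {g : Hq} (hg : normSq g = 1) (h : g ^ 4 = 1) :
    g.re = 0 ∨ g.re = 1 ∨ g.re = -1 := by
  have : (g - 1) * ((g + 1) * (g * g + 1)) = 0 := by
    have : (g - 1) * ((g + 1) * (g * g + 1)) = g ^ 4 - 1 := by noncomm_ring
    rw [this, h, sub_self]
  rcases mul_eq_zero.1 this with h | h
  · simp [sub_eq_zero.1 h]
  rcases mul_eq_zero.1 h with h | h
  · simp [eq_neg_of_add_eq_zero_left h]
  · left
    rw [re_eq_of_mul_self hg (c := 0) (by rw [eq_neg_of_add_eq_zero_left h]; simp)]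
    simp

open Quaternion in
lemma re_of_pow_six {g : Hq} (hg : normSq g = 1) (h : g ^ 6 = 1) :
    g.re = 1 ∨ g.re = -1 ∨ g.re = 1 / 2 ∨ g.re = -1 / 2 := by
  have : (g - 1) * ((g + 1) * ((g * g + g + 1) * (g * g - g + 1))) = 0 := by
    have : (g - 1) * ((g + 1) * ((g * g + g + 1) * (g * g - g + 1))) = g ^ 6 - 1 := by noncomm_ring
    rw [this, h, sub_self]
  rcases mul_eq_zero.1 this with h | h
  · simp [sub_eq_zero.1 h]
  rcases mul_eq_zero.1 h with h | h
  · simp [eq_neg_of_add_eq_zero_left h]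
  rcases mul_eq_zero.1 h with h | h
  · right; right; right
    refine re_eq_of_mul_self hg (c := -1) ?_
    rw [← sub_eq_zero, ← h]
    simp only [neg_smul, one_smul]
    abel
  · right; right; left
    refine re_eq_of_mul_self hg (c := 1) ?_
    rw [← sub_eq_zero, ← h]
    simp only [one_smul]
    abel

open Quaternion in
lemma re_of_pow_eight {g : Hq} (hg : normSq g = 1) (h : g ^ 8 = 1) :
    (g.re = 0 ∨ g.re = 1 ∨ g.re = -1) ∨ g.re = √2 / 2 ∨ g.re = -√2 / 2 := by
  have hf : (g ^ 4 - 1) * ((g * g - √2 • g + 1) * (g * g - (-√2) • g + 1)) = 0 := by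
    have : (g * g - √2 • g + 1) * (g * g - (-√2) • g + 1) = g ^ 4 + 1 := by
      rw [quadratic_mul_quadratic]
      simp
    rw [this]
    have : (g ^ 4 - 1) * (g ^ 4 + 1) = g ^ 8 - 1 := by noncomm_ring
    rw [this, h, sub_self]
  rcases mul_eq_zero.1 hf with h | h
  · exact Or.inl (re_of_pow_four hg (sub_eq_zero.1 h))
  right
  rcases mul_eq_zero.1 h with h | h
  · left
    refine re_eq_of_mul_self hg ?_
    rw [← sub_eq_zero, ← h]
    abel
  · right
    refine re_eq_of_mul_self hg ?_
    rw [← sub_eq_zero, ← h]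
    abel

lemma φg_sq : φg * φg = φg + 1 := by
  have : √5 * √5 = 5 := by simp
  simp only [φg]
  linarith

lemma φg_bounds : 1.6 < φg ∧ φg < 1.7 := by
  have h := φg_sq
  have h0 : 0 < φg := by simp only [φg]; positivity
  constructor <;> nlinarith

open Quaternion in
lemma re_of_pow_ten {g : Hq} (hg : normSq g = 1) (h : g ^ 10 = 1) :
    (g.re = 1 ∨ g.re = -1) ∨ g.re = φg / 2 ∨ g.re = -φg / 2 ∨
      g.re = (φg - 1) / 2 ∨ g.re = (1 - φg) / 2 := by
  have h1 : ∀ x : Hq, (x * x - φg • x + 1) * (x * x - (1 - φg) • x + 1) =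
      x ^ 4 - x ^ 3 + x ^ 2 - x + 1 := by
    intro x
    have h2 : 2 + φg * (1 - φg) = 1 := by linarith [φg_sq]
    simp [quadratic_mul_quadratic, h2]
  have hf : (g ^ 2 - 1) * (((g * g - φg • g + 1) * (g * g - (1 - φg) • g + 1)) *
      (((-g) * (-g) - φg • (-g) + 1) * ((-g) * (-g) - (1 - φg) • (-g) + 1))) = 0 := by
    rw [h1, h1]
    have : (g ^ 2 - 1) * ((g ^ 4 - g ^ 3 + g ^ 2 - g + 1) *
        ((-g) ^ 4 - (-g) ^ 3 + (-g) ^ 2 - (-g) + 1)) = g ^ 10 - 1 := by noncomm_ring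
    rw [this, h, sub_self]
  have hg' : normSq (-g) = 1 := by rw [normSq_neg, hg]
  have key : ∀ (x : Hq) (c : ℝ), normSq x = 1 → x * x - c • x + 1 = 0 → x.re = c / 2 := by
    intro x c hx h
    refine re_eq_of_mul_self hx ?_
    rw [← sub_eq_zero, ← h]
    abel
  rcases mul_eq_zero.1 hf with h | h
  · rcases eq_or_eq_neg_of_sq (sub_eq_zero.1 h) with h | h <;> simp [h]
  right
  rcases mul_eq_zero.1 h with h | h <;> rcases mul_eq_zero.1 h with h | h
  · exact Or.inl (key _ _ hg h)
  · exact Or.inr (Or.inr (Or.inr (key _ _ hg h)))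
  · right; left
    have := key _ _ hg' h
    simp at this
    linarith
  · right; right; left
    have := key _ _ hg' h
    simp at this
    linarith

/-- The unit quaternions (and their multiples) commuting with `p`. -/
def axisStab (p : Hq) : Subgroup Hqˣ where
  carrier := {g | Commute (g : Hq) p}
  mul_mem' ha hb := Commute.mul_left ha hb
  one_mem' := Commute.one_left p
  inv_mem' hg := Commute.units_inv_left hg

lemma mem_axisStab {p : Hq} {g : Hqˣ} : g ∈ axisStab p ↔ Commute (g : Hq) p := Iff.rfl

/-- The conjugate of a subgroup of `ℍ^×` by a unit. -/
abbrev conjSub (u : Hqˣ) (G : Subgroup Hqˣ) : Subgroup Hqˣ := G.map (MulAut.conj u).toMonoidHom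

lemma mem_conjSub {u g : Hqˣ} {G : Subgroup Hqˣ} :
    g ∈ conjSub u G ↔ ∃ h ∈ G, u * h * u⁻¹ = g := by
  simp [conjSub, Subgroup.mem_map]

lemma mem_conjSub_of_mul_eq {u g h : Hqˣ} {G : Subgroup Hqˣ} (hg : g ∈ G)
    (e : (u : Hq) * g = h * u) : h ∈ conjSub u G := by
  refine mem_conjSub.2 ⟨g, hg, ?_⟩
  rw [mul_inv_eq_iff_eq_mul]
  exact Units.ext (by simpa using e)

lemma card_conjSub (u : Hqˣ) (G : Subgroup Hqˣ) : Nat.card (conjSub u G) = Nat.card G :=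
  Subgroup.card_map_of_injective (MulAut.conj u).injective

lemma commute_conj {u : Hqˣ} {p q g h : Hq} (hp : (u : Hq) * p = q * u)
    (hg : (u : Hq) * g = h * u) :
    Commute g p ↔ Commute h q := by
  have e : q = u * p * (↑u⁻¹ : Hq) := by rw [hp]; simp
  have e' : h = u * g * (↑u⁻¹ : Hq) := by rw [hg]; simp
  have h1 : h * q = u * (g * p) * (↑u⁻¹ : Hq) := by rw [e, e']; simp [mul_assoc]
  have h2 : q * h = u * (p * g) * (↑u⁻¹ : Hq) := by rw [e, e']; simp [mul_assoc]
  unfold Commute SemiconjBy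
  rw [h1, h2]
  simp

lemma conjSub_inf_axisStab {u : Hqˣ} {p q : Hq} (hp : (u : Hq) * p = q * u) (G : Subgroup Hqˣ) :
    conjSub u (G ⊓ axisStab p) = conjSub u G ⊓ axisStab q := by
  ext g
  simp only [mem_conjSub, Subgroup.mem_inf, mem_axisStab]
  constructor
  · rintro ⟨h, ⟨hG, hc⟩, rfl⟩
    exact ⟨⟨h, hG, rfl⟩, (commute_conj hp (by simp)).1 hc⟩
  · rintro ⟨⟨h, hG, rfl⟩, hc⟩
    exact ⟨h, ⟨hG, (commute_conj hp (by simp)).2 hc⟩, rfl⟩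

lemma genQ_singleton (u : Hqˣ) : genQ {(u : Hq)} = Subgroup.zpowers u := by
  rw [genQ, Subgroup.zpowers_eq_closure]
  congr 1
  ext v
  simp [Units.val_inj]

lemma mem_genQ {S : Set Hq} {u : Hqˣ} (h : (u : Hq) ∈ S) : u ∈ genQ S :=
  Subgroup.subset_closure h

lemma genQ_le {S : Set Hq} {G : Subgroup Hqˣ} (h : ∀ u : Hqˣ, (u : Hq) ∈ S → u ∈ G) :
    genQ S ≤ G := (Subgroup.closure_le _).2 h

lemma genQ_mono {S T : Set Hq} (h : S ⊆ T) : genQ S ≤ genQ T :=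
  genQ_le fun _ hu => mem_genQ (h hu)

/-- The complex root of unity `e^{2πi/d}` as a unit quaternion. -/
def ζu (d : ℕ) : Hqˣ :=
  Units.map (Quaternion.ofComplex : ℂ →* Hq)
    (Units.mk0 (Complex.exp (2 * Real.pi * Complex.I / d)) (Complex.exp_ne_zero _))

lemma coe_ζu (d : ℕ) : (ζu d : Hq) = ζq d := by
  have : 2 * Real.pi * Complex.I / d = ((2 * Real.pi / d : ℝ) : ℂ) * Complex.I := by
    push_cast; ring
  have e : (ζu d : Hq) = Quaternion.coeComplex (Complex.exp (2 * Real.pi * Complex.I / d)) := rfl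
  rw [e, this, ζq_eq_mkQ]
  generalize 2 * Real.pi / (d : ℝ) = x
  ext <;> simp [Complex.exp_ofReal_mul_I_re, Complex.exp_ofReal_mul_I_im]

lemma coeComplex_injective : Function.Injective Quaternion.coeComplex := fun z w h =>
  Complex.ext (by simpa using congrArg QuaternionAlgebra.re h)
    (by simpa using congrArg QuaternionAlgebra.imI h)

lemma orderOf_ζu {d : ℕ} (hd : d ≠ 0) : orderOf (ζu d) = d := by
  rw [ζu, orderOf_injective _ (Units.map_injective coeComplex_injective), ← orderOf_units,
    Units.val_mk0, (Complex.isPrimitiveRoot_exp d hd).eq_orderOf.symm]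

lemma cycQ_eq_zpowers (d : ℕ) : cycQ d = Subgroup.zpowers (ζu d) := by
  rw [cycQ, ← coe_ζu, genQ_singleton]

lemma card_cycQ {d : ℕ} (hd : d ≠ 0) : Nat.card (cycQ d) = d := by
  rw [cycQ_eq_zpowers, Nat.card_zpowers, orderOf_ζu hd]

lemma eq_coeComplex_of_commute {g : Hq} (h : Commute g iq) :
    g = Quaternion.coeComplex ⟨g.re, g.imI⟩ := by
  have h2 := congrArg QuaternionAlgebra.imJ h.eq
  have h3 := congrArg QuaternionAlgebra.imK h.eq
  simp [iq_eq_mkQ] at h2 h3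
  ext <;> simp <;> linarith

lemma iq_mul_self : iq * iq = -1 := by
  ext <;> simp [iq_eq_mkQ] <;> rfl

lemma jq_mul_self : jq * jq = -1 := by
  ext <;> simp [jq_eq_mkQ] <;> rfl

/-- A finite subgroup of `ℂ^×` is the group of `d`-th roots of unity. -/
lemma eq_cycQ_of_le {H : Subgroup Hqˣ} [Finite H] (hH : H ≤ axisStab iq) :
    H = cycQ (Nat.card H) := by
  have hpos : Nat.card H ≠ 0 := Nat.card_pos.ne'
  have hle : H ≤ cycQ (Nat.card H) := by
    intro g hg
    have hgi := eq_coeComplex_of_commute (hH hg)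
    obtain ⟨z, hz⟩ : ∃ z : ℂ, (g : Hq) = Quaternion.coeComplex z := ⟨_, hgi⟩
    have hpow : g ^ Nat.card H = 1 :=
      congrArg Subtype.val (pow_card_eq_one' (x := (⟨g, hg⟩ : H)))
    have hzpow : z ^ Nat.card H = 1 := by
      apply coeComplex_injective
      have := congrArg Units.val hpow
      rw [Units.val_pow_eq_pow_val, hz] at this
      simpa [← Quaternion.coe_ofComplex] using this
    have : NeZero (Nat.card H) := ⟨hpos⟩
    obtain ⟨i, -, hi⟩ := (Complex.isPrimitiveRoot_exp _ hpos).eq_pow_of_pow_eq_one hzpow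
    rw [cycQ_eq_zpowers]
    refine Subgroup.mem_zpowers_iff.2 ⟨i, Units.ext ?_⟩
    rw [hz, ← hi, zpow_natCast, ← Quaternion.coe_ofComplex, map_pow]
    rfl
  have : Finite (cycQ (Nat.card H)) := Nat.finite_of_card_ne_zero (by rwa [card_cycQ hpos])
  exact Subgroup.eq_of_le_of_card_ge hle (card_cycQ hpos).le

lemma conjSub_eq_cycQ {H : Subgroup Hqˣ} [Finite H] {p : Hq} (hH : H ≤ axisStab p) {u : Hqˣ}
    (hu : (u : Hq) * p = iq * u) : conjSub u H = cycQ (Nat.card H) := by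
  have : Finite (conjSub u H) := Nat.finite_of_card_ne_zero (by
    rw [card_conjSub]; exact Nat.card_pos.ne')
  rw [← card_conjSub u H]
  apply eq_cycQ_of_le
  rw [← inf_eq_left.2 hH, conjSub_inf_axisStab hu]
  exact inf_le_right

/-- A cyclic stabilizer of order `d` contains a rotation with trace `2 cos (2π/d)`. -/
lemma exists_re_eq_cos {H : Subgroup Hqˣ} [Finite H] {p : Hq} (hp : p * p = -1)
    (hH : H ≤ axisStab p) : ∃ s ∈ H, (s : Hq).re = Real.cos (2 * Real.pi / Nat.card H) := by
  obtain ⟨u, hu⟩ := exists_conj_axis hp iq_mul_self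
  have h := conjSub_eq_cycQ hH hu
  have hm : ζu (Nat.card H) ∈ conjSub u H := by
    rw [h, cycQ_eq_zpowers]; exact Subgroup.mem_zpowers _
  obtain ⟨s, hs, e⟩ := mem_conjSub.1 hm
  refine ⟨s, hs, ?_⟩
  have := re_conj u (s : Hq)
  rw [← this, ← Units.val_mul, ← Units.val_mul, e, coe_ζu, ζq_eq_mkQ, mkQ_re]

lemma two_mul_card_le_of_lt {G : Type*} [Group G] {K L : Subgroup G} [Finite L] (h : K < L) :
    2 * Nat.card K ≤ Nat.card L := by
  obtain ⟨k, hk⟩ := Subgroup.card_dvd_of_le h.le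
  have h1 : Nat.card K ≠ Nat.card L := fun e => h.ne (Subgroup.eq_of_le_of_card_ge h.le e.ge)
  have h2 : 0 < Nat.card L := Nat.card_pos
  have : 2 ≤ k := by
    by_contra! hcon
    interval_cases k <;> omega
  rw [hk, mul_comm]
  exact Nat.mul_le_mul_left _ this

/-- The counting formula of Burnside for an action in which every element outside the
kernel `K` has exactly two fixed points. -/
lemma sum_one_sub_card_div_card_stabilizer {G X : Type*} [Group G] [MulAction G X] [Finite G]
    [Fintype (Quotient (MulAction.orbitRel G X))] [Finite X] (K : Subgroup G)
    (hK : ∀ g ∈ K, ∀ x : X, g • x = x)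
    (h2 : ∀ g ∉ K, Nat.card (MulAction.fixedBy X g) = 2) :
    ∑ ω : Quotient (MulAction.orbitRel G X),
      (1 - (Nat.card K : ℚ) / Nat.card (MulAction.stabilizer G ω.out)) =
        2 - 2 * (Nat.card K : ℚ) / Nat.card G := by
  classical
  have := Fintype.ofFinite G
  have := Fintype.ofFinite X
  have hN : (Nat.card G : ℚ) ≠ 0 := by exact_mod_cast Nat.card_pos.ne'
  have hB := MulAction.sum_card_fixedBy_eq_card_orbits_mul_card_group G X
  have hO := MulAction.card_eq_sum_card_group_div_card_stabilizer G X
  simp only [← Nat.card_eq_fintype_card] at hB hO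
  have hO' : (Nat.card X : ℚ) = ∑ ω : Quotient (MulAction.orbitRel G X),
      (Nat.card G : ℚ) / Nat.card (MulAction.stabilizer G ω.out) := by
    rw [hO, Nat.cast_sum]
    refine Finset.sum_congr (by congr) fun ω _ => ?_
    rw [Nat.cast_div (Subgroup.card_subgroup_dvd_card _)]
    exact_mod_cast Nat.card_pos.ne'
  have hfix : ∀ g : G, Nat.card (MulAction.fixedBy X g) =
      2 + if g ∈ K then (Nat.card X : ℤ) - 2 else 0 := by
    intro g
    split_ifs with hg
    · have : MulAction.fixedBy X g = Set.univ := Set.eq_univ_of_forall (hK g hg)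
      rw [this, Nat.card_univ]; ring
    · rw [h2 g hg]; rfl
  have hcK : (Finset.univ.filter (· ∈ K)).card = Nat.card K := by
    rw [Nat.card_eq_fintype_card, ← Fintype.card_subtype]
  have hB' : 2 * (Nat.card G : ℤ) + Nat.card K * (Nat.card X - 2) =
      Nat.card (Quotient (MulAction.orbitRel G X)) * Nat.card G := by
    have := congrArg (Nat.cast (R := ℤ)) hB
    rw [Nat.cast_sum] at this
    simp only [hfix] at this
    rw [Finset.sum_add_distrib, Finset.sum_ite] at this
    simp only [Finset.sum_const, Finset.card_univ, hcK, nsmul_eq_mul, mul_zero, add_zero,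
      ← Nat.card_eq_fintype_card] at this
    push_cast at this
    convert this using 1
    ring
  have hB'' : 2 * (Nat.card G : ℚ) + Nat.card K * (Nat.card X - 2) =
      Nat.card (Quotient (MulAction.orbitRel G X)) * Nat.card G := by exact_mod_cast hB'
  rw [Finset.sum_sub_distrib]
  simp only [Finset.sum_const, Finset.card_univ, ← Nat.card_eq_fintype_card, nsmul_eq_mul, mul_one]
  have hs : ∑ ω : Quotient (MulAction.orbitRel G X),
      (Nat.card K : ℚ) / Nat.card (MulAction.stabilizer G ω.out) =
        Nat.card K * Nat.card X / Nat.card G := by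
    rw [hO', Finset.mul_sum, Finset.sum_div]
    refine Finset.sum_congr rfl fun ω _ => ?_
    field_simp
  rw [hs]
  field_simp
  linarith

/-- The positive solutions of `1/a + 1/b + 1/c = 1 + 2/n`. -/
lemma triple_of_sum_inv {a b c n : ℕ} (ha : 2 ≤ a) (hab : a ≤ b) (hbc : b ≤ c)
    (hn : 0 < n) (h : (1 / a + 1 / b + 1 / c : ℚ) = 1 + 2 / n) :
    a = 2 ∧ (n = 2 * c ∨ b = 3 ∧ (c = 3 ∧ n = 12 ∨ c = 4 ∧ n = 24 ∨ c = 5 ∧ n = 60)) := by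
  have hb : 0 < b := by omega
  have hc : 0 < c := by omega
  have h' : n * (b * c + a * c + a * b) = a * b * c * (n + 2) := by
    have ha' : (a : ℚ) ≠ 0 := by positivity
    field_simp at h
    have : (n * (b * c + a * c + a * b) : ℚ) = a * b * c * (n + 2) := by linarith
    exact_mod_cast this
  have ha3 : a < 3 := by
    by_contra! hcon
    have h1 : n * (b * c) * 3 ≤ n * (b * c) * a := Nat.mul_le_mul_left _ hcon
    have h2 : a * c ≤ b * c := Nat.mul_le_mul_right _ hab
    have h3 : a * b ≤ b * c := by rw [mul_comm b c]; exact Nat.mul_le_mul_right _ (hab.trans hbc)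
    have h4 : n * (b * c + a * c + a * b) ≤ n * (b * c) * 3 := by
      have : b * c + a * c + a * b ≤ b * c * 3 := by omega
      calc _ ≤ n * (b * c * 3) := Nat.mul_le_mul_left _ this
        _ = _ := by ring
    have h5 : 0 < a * b * c := by positivity
    nlinarith
  obtain rfl : a = 2 := by omega
  refine ⟨rfl, ?_⟩
  have hb4 : b < 4 := by
    by_contra! hcon
    have h1 : n * c * 4 ≤ n * c * b := Nat.mul_le_mul_left _ hcon
    have h2 : n * b ≤ n * c := Nat.mul_le_mul_left _ hbc
    have h5 : 0 < b * c := by positivity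
    nlinarith
  interval_cases b
  · left; nlinarith
  · right
    refine ⟨rfl, ?_⟩
    have hc6 : c < 6 := by
      by_contra! hcon
      nlinarith
    interval_cases c <;> omega

/-- The arithmetic of Klein's equation `∑ (1 - 1/mᵢ) = 2 - 2/n`. -/
lemma exists_of_sum_one_sub_inv {Ω : Type*} [Fintype Ω] {m : Ω → ℕ} {n : ℕ} (hn : 2 ≤ n)
    (hm : ∀ ω, 2 ≤ m ω) (hmn : ∀ ω, m ω ∣ n) (h : ∑ ω, (1 - 1 / (m ω : ℚ)) = 2 - 2 / n) :
    (∃ ω, m ω = n) ∨ (∃ ω, m ω = 2) ∧ ∃ ω, n = 2 * m ω ∨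
      (m ω = 3 ∧ n = 12 ∨ m ω = 4 ∧ n = 24 ∨ m ω = 5 ∧ n = 60) ∧
        ∀ ω', m ω' = 2 ∨ m ω' = 3 ∨ m ω' = m ω := by
  have hinv : ∀ ω, 1 / (m ω : ℚ) ≤ 1 / 2 := fun ω =>
    one_div_le_one_div_of_le two_pos (by exact_mod_cast hm ω)
  have hinv' : ∀ ω, 1 / (n : ℚ) ≤ 1 / m ω := fun ω => by
    have := hm ω
    exact one_div_le_one_div_of_le (by positivity)
      (by exact_mod_cast Nat.le_of_dvd (by omega) (hmn ω))
  have hnpos : (0 : ℚ) < 1 / n := by positivity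
  have hnle : 1 / (n : ℚ) ≤ 1 / 2 := one_div_le_one_div_of_le two_pos (by exact_mod_cast hn)
  have h2n : (2 : ℚ) / n = 2 * (1 / n) := by ring
  have hcard : Fintype.card Ω < 4 := by
    by_contra! hcon
    have : (Fintype.card Ω : ℚ) * (1 / 2) ≤ ∑ ω, (1 - 1 / (m ω : ℚ)) := by
      rw [← nsmul_eq_mul, ← Finset.card_univ]
      exact Finset.card_nsmul_le_sum _ _ _ fun ω _ => by linarith [hinv ω]
    have : (4 : ℚ) ≤ Fintype.card Ω := by exact_mod_cast hcon
    linarith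
  obtain ⟨k, hk⟩ : ∃ k, Fintype.card Ω = k := ⟨_, rfl⟩
  have e := Fintype.equivFinOfCardEq hk
  rw [hk] at hcard
  rw [← Equiv.sum_comp e.symm] at h
  interval_cases k
  · rw [Fin.sum_univ_zero] at h
    linarith
  · rw [Fin.sum_univ_one] at h
    have := hm (e.symm 0)
    have : (0 : ℚ) < 1 / m (e.symm 0) := by positivity
    linarith
  · rw [Fin.sum_univ_two] at h
    left
    refine ⟨e.symm 0, ?_⟩
    have h1 : 1 / (m (e.symm 0) : ℚ) = 1 / n := by linarith [hinv' (e.symm 0), hinv' (e.symm 1)]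
    rw [one_div, one_div, inv_inj] at h1
    exact_mod_cast h1
  · right
    rw [Fin.sum_univ_three] at h
    have hcov : ∀ ω, ω = e.symm 0 ∨ ω = e.symm 1 ∨ ω = e.symm 2 := by
      intro ω
      obtain ⟨i, rfl⟩ := e.symm.surjective ω
      fin_cases i <;> simp
    have key : ∀ a b c : Ω, m a ≤ m b → m b ≤ m c → (∀ ω, ω = a ∨ ω = b ∨ ω = c) →
        (1 / m a + 1 / m b + 1 / m c : ℚ) = 1 + 2 / n →
        (∃ ω, m ω = 2) ∧ ∃ ω, n = 2 * m ω ∨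
          (m ω = 3 ∧ n = 12 ∨ m ω = 4 ∧ n = 24 ∨ m ω = 5 ∧ n = 60) ∧
            ∀ ω', m ω' = 2 ∨ m ω' = 3 ∨ m ω' = m ω := by
      intro a b c hab hbc hcov h
      obtain ⟨h1, h2⟩ := triple_of_sum_inv (hm a) hab hbc (by omega) h
      refine ⟨⟨a, h1⟩, c, h2.imp_right fun ⟨h3, h4⟩ => ⟨h4, fun ω' => ?_⟩⟩
      rcases hcov ω' with rfl | rfl | rfl <;> simp [h1, h3]
    generalize e.symm 0 = a at h hcov
    generalize e.symm 1 = b at h hcov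
    generalize e.symm 2 = c at h hcov
    have hc1 : ∀ ω, ω = a ∨ ω = c ∨ ω = b := fun ω => by have := hcov ω; tauto
    have hc2 : ∀ ω, ω = b ∨ ω = a ∨ ω = c := fun ω => by have := hcov ω; tauto
    have hc3 : ∀ ω, ω = b ∨ ω = c ∨ ω = a := fun ω => by have := hcov ω; tauto
    have hc4 : ∀ ω, ω = c ∨ ω = a ∨ ω = b := fun ω => by have := hcov ω; tauto
    have hc5 : ∀ ω, ω = c ∨ ω = b ∨ ω = a := fun ω => by have := hcov ω; tauto
    rcases le_total (m a) (m b) with hab | hab <;> rcases le_total (m b) (m c) with hbc | hbc <;>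
      rcases le_total (m a) (m c) with hac | hac
    · exact key a b c hab hbc hcov (by linarith)
    · exact key a b c hab hbc hcov (by linarith)
    · exact key a c b hac hbc hc1 (by linarith)
    · exact key c a b hac hab hc4 (by linarith)
    · exact key b a c hab hac hc2 (by linarith)
    · exact key b c a hbc hac hc3 (by linarith)
    · exact key c b a hbc hab hc5 (by linarith)
    · exact key c b a hbc hab hc5 (by linarith)

/-- The unit imaginary quaternions `p` that commute with a noncentral element of `G`. -/
@[ext]
structure Pole (G : Subgroup Hqˣ) where
  /-- The underlying quaternion. -/
  val : Hq
  mul_self : val * val = -1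
  exists_commute : ∃ g ∈ G, (g : Hq) ≠ 1 ∧ (g : Hq) ≠ -1 ∧ Commute (g : Hq) val

instance (G : Subgroup Hqˣ) : MulAction G (Pole G) where
  smul g p := ⟨(g : Hqˣ) * p.val * (↑(g : Hqˣ)⁻¹ : Hq), mul_self_conj p.mul_self _, by
    obtain ⟨h, hG, h1, h2, hc⟩ := p.exists_commute
    refine ⟨g * h * (g : Hqˣ)⁻¹, mul_mem (mul_mem g.2 hG) (inv_mem g.2), ?_, ?_, ?_⟩
    · intro e
      apply h1
      rw [Units.val_mul, Units.val_mul, Units.mul_inv_eq_iff_eq_mul] at e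
      rw [← Units.mul_right_inj (g : Hqˣ), e]
      simp
    · intro e
      apply h2
      rw [Units.val_mul, Units.val_mul, Units.mul_inv_eq_iff_eq_mul] at e
      rw [← Units.mul_right_inj (g : Hqˣ), e]
      simp
    · exact (commute_conj (u := g) (by simp) (by simp)).1 hc⟩
  one_smul p := Pole.ext (by
    change ((1 : Hqˣ) : Hq) * p.val * ((1 : Hqˣ)⁻¹ : Hqˣ) = p.val
    simp)
  mul_smul g h p := Pole.ext (by
    change ((g * h : Hqˣ) : Hq) * p.val * ((g * h : Hqˣ)⁻¹ : Hqˣ) =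
      (g : Hqˣ) * ((h : Hqˣ) * p.val * ((h : Hqˣ)⁻¹ : Hqˣ)) * ((g : Hqˣ)⁻¹ : Hqˣ)
    simp [mul_assoc])

lemma pole_smul_eq_iff {G : Subgroup Hqˣ} {g : G} {p : Pole G} :
    g • p = p ↔ Commute ((g : Hqˣ) : Hq) p.val := by
  rw [Pole.ext_iff]
  change (g : Hqˣ) * p.val * ((g : Hqˣ)⁻¹ : Hqˣ) = p.val ↔ _
  rw [Units.mul_inv_eq_iff_eq_mul]
  rfl

lemma stabilizer_pole {G : Subgroup Hqˣ} (p : Pole G) :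
    MulAction.stabilizer G p = (axisStab p.val).subgroupOf G := by
  ext g
  rw [MulAction.mem_stabilizer_iff, pole_smul_eq_iff, Subgroup.mem_subgroupOf, mem_axisStab]

lemma card_stabilizer_pole {G : Subgroup Hqˣ} (p : Pole G) :
    Nat.card (MulAction.stabilizer G p) = Nat.card ↥(G ⊓ axisStab p.val) := by
  rw [stabilizer_pole, inf_comm, ← Subgroup.subgroupOf_map_subtype,
    Subgroup.card_map_of_injective G.subtype_injective]

lemma fixedBy_pole {G : Subgroup Hqˣ} [Finite G] {g : G} (h1 : ((g : Hqˣ) : Hq) ≠ 1)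
    (h2 : ((g : Hqˣ) : Hq) ≠ -1) :
    ∃ p q : Pole G, p ≠ q ∧ MulAction.fixedBy (Pole G) g = {p, q} := by
  obtain ⟨p, r, hp, hr, hg⟩ := exists_axis (normSq_eq_one_of_mem g.2) h1 h2
  have hc : Commute ((g : Hqˣ) : Hq) p :=
    (commute_iff_of_eq_add hr hg _).1 (Commute.refl _)
  refine ⟨⟨p, hp, g, g.2, h1, h2, hc⟩, ⟨-p, by simp [hp], g, g.2, h1, h2, hc.neg_right⟩, ?_, ?_⟩
  · intro e
    have e' : p = -p := congrArg Pole.val e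
    have h0 : (2 : ℝ) • p = 0 := by rw [two_smul]; nth_rewrite 2 [e']; exact add_neg_cancel p
    exact ne_zero_of_mul_self hp ((smul_eq_zero.1 h0).resolve_left two_ne_zero)
  · ext q
    rw [MulAction.mem_fixedBy, pole_smul_eq_iff]
    simp only [Set.mem_insert_iff, Set.mem_singleton_iff, Pole.ext_iff]
    constructor
    · intro h
      exact eq_or_eq_neg_of_commute hp q.mul_self (((commute_iff_of_eq_add hr hg _).1 h.symm).symm)
    · rintro (h | h) <;> rw [h]
      exacts [hc, hc.neg_right]

instance (G : Subgroup Hqˣ) [Finite G] : Finite (Pole G) := by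
  rw [← Set.finite_univ_iff]
  have : (Set.univ : Set (Pole G)) ⊆
      ⋃ g : {g : G // ((g : Hqˣ) : Hq) ≠ 1 ∧ ((g : Hqˣ) : Hq) ≠ -1},
        MulAction.fixedBy (Pole G) g.1 := by
    intro p _
    obtain ⟨g, hG, h1, h2, hc⟩ := p.exists_commute
    exact Set.mem_iUnion.2 ⟨⟨⟨g, hG⟩, h1, h2⟩, pole_smul_eq_iff.2 hc⟩
  refine (Set.finite_iUnion fun g => ?_).subset this
  obtain ⟨p, q, -, h⟩ := fixedBy_pole g.2.1 g.2.2
  rw [h]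
  exact Set.toFinite _

/-- The subgroup `G ∩ {1, -1}` of `G`. -/
def signSub (G : Subgroup Hqˣ) : Subgroup G where
  carrier := {g | ((g : Hqˣ) : Hq) = 1 ∨ ((g : Hqˣ) : Hq) = -1}
  mul_mem' := by
    rintro a b ha hb
    simp only [Set.mem_ofPred_eq, Subgroup.coe_mul, Units.val_mul] at *
    rcases ha with ha | ha <;> rcases hb with hb | hb <;> rw [ha, hb] <;> simp
  one_mem' := by simp
  inv_mem' := by
    rintro a (ha | ha)
    · left; simp [Units.val_inv_eq_inv_val, ha]
    · right; simp [Units.val_inv_eq_inv_val, ha]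

lemma mem_signSub {G : Subgroup Hqˣ} {g : G} :
    g ∈ signSub G ↔ ((g : Hqˣ) : Hq) = 1 ∨ ((g : Hqˣ) : Hq) = -1 := Iff.rfl

lemma commute_of_mem_signSub {G : Subgroup Hqˣ} {g : G} (hg : g ∈ signSub G) (p : Hq) :
    Commute ((g : Hqˣ) : Hq) p := by
  rcases hg with h | h <;> rw [h]
  exacts [Commute.one_left p, (Commute.one_left p).neg_left]

lemma card_signSub {G : Subgroup Hqˣ} (h : (-1 : Hqˣ) ∈ G) : Nat.card (signSub G) = 2 := by
  have : (signSub G : Set G) = {1, ⟨-1, h⟩} := by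
    ext g
    rw [SetLike.mem_coe, mem_signSub, Set.mem_insert_iff, Set.mem_singleton_iff, Subtype.ext_iff,
      Subtype.ext_iff, Units.ext_iff, Units.ext_iff]
    rfl
  rw [← SetLike.coe_sort_coe, this, Nat.card_coe_set_eq, Set.ncard_pair]
  intro e
  have e' : (1 : Hq) = -1 := congrArg (fun g : G => ((g : Hqˣ) : Hq)) e
  have := congrArg QuaternionAlgebra.re e'
  rw [Quaternion.re_neg, Quaternion.re_one] at this
  norm_num at this

lemma neg_one_mem_of_even {G : Subgroup Hqˣ} [Finite G] (h : 2 ∣ Nat.card G) : (-1 : Hqˣ) ∈ G := by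
  have : Fact (Nat.Prime 2) := ⟨Nat.prime_two⟩
  obtain ⟨g, hg⟩ := exists_prime_orderOf_dvd_card' 2 h
  have h1 : ((g : Hqˣ) : Hq) ^ 2 = 1 := by
    have := pow_orderOf_eq_one g
    rw [hg] at this
    simpa using congrArg (fun g : G => ((g : Hqˣ) : Hq)) this
  rcases eq_or_eq_neg_of_sq h1 with h | h
  · have : g = 1 := Subtype.ext (Units.ext h)
    rw [this, orderOf_one] at hg
    omega
  · have : (g : Hqˣ) = -1 := Units.ext h
    exact this ▸ g.2

lemma signSub_le_stabilizer {G : Subgroup Hqˣ} (p : Pole G) :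
    signSub G ≤ MulAction.stabilizer G p := fun _ hg =>
  pole_smul_eq_iff.2 (commute_of_mem_signSub hg _)

lemma signSub_lt_stabilizer {G : Subgroup Hqˣ} (p : Pole G) :
    signSub G < MulAction.stabilizer G p := by
  refine lt_of_le_not_ge (signSub_le_stabilizer p) fun hle => ?_
  obtain ⟨g, hG, h1, h2, hc⟩ := p.exists_commute
  have : (⟨g, hG⟩ : G) ∈ signSub G := hle (pole_smul_eq_iff.2 hc)
  exact (this.elim h1 h2).elim

/-- The classification of the finite subgroups of the unit quaternions by the orders of the
stabilizers of axes. -/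
lemma axis_trichotomy (G : Subgroup Hqˣ) [Finite G] :
    (∃ p : Hq, p * p = -1 ∧ G ≤ axisStab p) ∨
    (∃ (p : Hq) (m : ℕ), p * p = -1 ∧ 2 ≤ m ∧ Nat.card ↥(G ⊓ axisStab p) = 2 * m ∧
      Nat.card G = 4 * m) ∨
    ∃ (p : Hq) (m : ℕ), p * p = -1 ∧ Nat.card ↥(G ⊓ axisStab p) = 2 * m ∧
      (m = 3 ∧ Nat.card G = 24 ∨ m = 4 ∧ Nat.card G = 48 ∨ m = 5 ∧ Nat.card G = 120) ∧
      ∀ g ∈ G, (g : Hq) ^ 4 = 1 ∨ (g : Hq) ^ 6 = 1 ∨ (g : Hq) ^ (2 * m) = 1 := by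
  classical
  by_cases htriv : signSub G = ⊤
  · refine Or.inl ⟨iq, iq_mul_self, fun g hg => ?_⟩
    exact commute_of_mem_signSub (G := G) (g := ⟨g, hg⟩) (htriv ▸ Subgroup.mem_top _) _
  have := Fintype.ofFinite (Quotient (MulAction.orbitRel G (Pole G)))
  have hsum := sum_one_sub_card_div_card_stabilizer (X := Pole G) (signSub G)
    (fun g hg p => signSub_le_stabilizer p hg) (fun g hg => by
      rw [mem_signSub, not_or] at hg
      obtain ⟨p, q, hpq, h⟩ := fixedBy_pole hg.1 hg.2
      rw [h, Nat.card_coe_set_eq, Set.ncard_pair hpq])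
  set c := Nat.card (signSub G) with hc
  have hcpos : 0 < c := Nat.card_pos
  obtain ⟨n, hn⟩ : c ∣ Nat.card G := Subgroup.card_subgroup_dvd_card _
  choose m hm using fun ω : Quotient (MulAction.orbitRel G (Pole G)) =>
    Subgroup.card_dvd_of_le (signSub_le_stabilizer ω.out)
  rw [← hc] at hm
  have hn2 : 2 ≤ n := by
    have := two_mul_card_le_of_lt (lt_top_iff_ne_top.2 htriv)
    rw [Subgroup.card_top, hn, ← hc, mul_comm] at this
    exact le_of_mul_le_mul_left this hcpos
  have hm2 : ∀ ω, 2 ≤ m ω := fun ω => by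
    have := two_mul_card_le_of_lt (signSub_lt_stabilizer ω.out)
    rw [hm, ← hc, mul_comm] at this
    exact le_of_mul_le_mul_left this hcpos
  have hmn : ∀ ω, m ω ∣ n := fun ω => by
    have := Subgroup.card_subgroup_dvd_card (MulAction.stabilizer G ω.out)
    rw [hm, hn] at this
    exact Nat.dvd_of_mul_dvd_mul_left hcpos this
  have hkey := exists_of_sum_one_sub_inv hn2 hm2 hmn (by
    have hcQ : (c : ℚ) ≠ 0 := by positivity
    convert hsum using 1
    · refine Finset.sum_congr rfl fun ω _ => ?_
      rw [hm]
      push_cast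
      field_simp
    · rw [hn]
      push_cast
      field_simp)
  rcases hkey with ⟨ω, hω⟩ | ⟨⟨ω₀, h₀⟩, ω, hω⟩
  · refine Or.inl ⟨ω.out.val, ω.out.mul_self, ?_⟩
    have h1 := hm ω
    rw [hω, ← hn, card_stabilizer_pole] at h1
    exact inf_eq_left.1 (Subgroup.eq_of_le_of_card_ge inf_le_left h1.ge)
  have hc2 : c = 2 := by
    apply card_signSub
    apply neg_one_mem_of_even
    exact (Dvd.intro_left c (h₀ ▸ (hm ω₀).symm)).trans (Subgroup.card_subgroup_dvd_card _)
  rw [hc2] at hn hm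
  right
  rcases hω with hω | ⟨h1, h2⟩
  · refine Or.inl ⟨ω.out.val, m ω, ω.out.mul_self, hm2 ω, ?_, by rw [hn, hω]; ring⟩
    rw [← card_stabilizer_pole, hm]
  · refine Or.inr ⟨ω.out.val, m ω, ω.out.mul_self, by rw [← card_stabilizer_pole, hm], by omega, ?_⟩
    intro g hg
    by_cases hs : (⟨g, hg⟩ : G) ∈ signSub G
    · left
      rcases hs with h | h
      all_goals
        rw [show (g : Hq) = _ from h]
        norm_num
    rw [mem_signSub, not_or] at hs
    obtain ⟨p, q, -, hpq⟩ := fixedBy_pole hs.1 hs.2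
    have hgp : (⟨g, hg⟩ : G) ∈ MulAction.stabilizer G p := by
      rw [MulAction.mem_stabilizer_iff, ← MulAction.mem_fixedBy, hpq]
      simp
    have hcard : Nat.card (MulAction.stabilizer G p) = 2 * m (Quotient.mk'' p) := by
      rw [← hm]
      refine Nat.card_congr (MulAction.stabilizerEquivStabilizerOfOrbitRel ?_).toEquiv
      exact (MulAction.orbitRel G (Pole G)).symm (Quotient.mk_out p)
    have hpow : (g : Hq) ^ (2 * m (Quotient.mk'' p)) = 1 := by
      have := pow_card_eq_one' (x := (⟨⟨g, hg⟩, hgp⟩ : MulAction.stabilizer G p))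
      rw [hcard] at this
      simpa using congrArg (fun g : MulAction.stabilizer G p => (((g : G) : Hqˣ) : Hq)) this
    rcases h2 (Quotient.mk'' p) with h | h | h <;> rw [h] at hpow
    exacts [Or.inl hpow, Or.inr (Or.inl hpow), Or.inr (Or.inr hpow)]

lemma commute_of_commute_axis {p x y : Hq} (hp : p * p = -1) (hx : Commute x p)
    (hy : Commute y p) : Commute x y := by
  obtain ⟨u, hu⟩ := exists_conj_axis hp iq_mul_self
  have e : ∀ z : Hq, (u : Hq) * z = (u * z * (↑u⁻¹ : Hq)) * u := fun z => by simp
  rw [commute_conj (e y) (e x), eq_coeComplex_of_commute ((commute_conj hu (e x)).1 hx),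
    eq_coeComplex_of_commute ((commute_conj hu (e y)).1 hy)]
  exact (Commute.all _ _).map Quaternion.ofComplex

lemma commute_iff_of_not_central {p s : Hq} (hp : p * p = -1) (hs : Quaternion.normSq s = 1)
    (h1 : s ≠ 1) (h2 : s ≠ -1) (hc : Commute s p) (x : Hq) : Commute x s ↔ Commute x p := by
  obtain ⟨q, r, hq, hr, e⟩ := exists_axis hs h1 h2
  rw [commute_iff_of_eq_add hr e]
  have := (commute_iff_of_eq_add hr e p).1 hc.symm
  rcases eq_or_eq_neg_of_commute hp hq this with rfl | rfl
  · rfl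
  · exact Commute.neg_right_iff

/-- A cyclic stabilizer of even order `2m ≥ 4` contains an element of trace `2 cos (π/m)`, and
this element determines the axis. -/
lemma exists_generator_of_axis {G : Subgroup Hqˣ} [Finite G] {p : Hq} {m : ℕ} (hp : p * p = -1)
    (hm : 2 ≤ m) (hS : Nat.card ↥(G ⊓ axisStab p) = 2 * m) :
    ∃ s ∈ G, (s : Hq).re = Real.cos (Real.pi / m) ∧ ∀ x, Commute x (s : Hq) ↔ Commute x p := by
  have : Finite ↥(G ⊓ axisStab p) := Nat.finite_of_card_ne_zero (by omega)
  obtain ⟨s, ⟨hsG, hsp⟩, hs⟩ := exists_re_eq_cos (H := G ⊓ axisStab p) hp inf_le_right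
  have e : 2 * Real.pi / ((2 * m : ℕ) : ℝ) = Real.pi / m := by
    push_cast
    exact mul_div_mul_left _ _ two_ne_zero
  rw [hS, e] at hs
  have hm' : (2 : ℝ) ≤ m := by exact_mod_cast hm
  have hpi := Real.pi_pos
  have hle : Real.pi / m ≤ Real.pi / 2 := div_le_div_of_nonneg_left hpi.le two_pos hm'
  have hpos : 0 < Real.pi / m := by positivity
  refine ⟨s, hsG, hs, commute_iff_of_not_central hp (normSq_eq_one_of_mem hsG) ?_ ?_ hsp⟩
  · intro h
    have h1 : Real.cos (Real.pi / m) < Real.cos 0 :=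
      Real.cos_lt_cos_of_nonneg_of_le_pi le_rfl (by linarith) hpos
    rw [← hs, h, Real.cos_zero, Quaternion.re_one] at h1
    exact lt_irrefl _ h1
  · intro h
    have h1 : Real.cos Real.pi < Real.cos (Real.pi / m) :=
      Real.cos_lt_cos_of_nonneg_of_le_pi hpos.le le_rfl (by linarith)
    rw [← hs, h, Real.cos_pi, Quaternion.re_neg, Quaternion.re_one] at h1
    exact lt_irrefl _ h1

/-- A unit conjugating a rotation into one with the same axis preserves or reverses the axis. -/
lemma mul_axis_of_commute_conj {p s : Hq} (hp : p * p = -1)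
    (hsp : ∀ x, Commute x s ↔ Commute x p) {g : Hqˣ} (h : Commute (g * s * (↑g⁻¹ : Hq)) p) :
    (g : Hq) * p = p * g ∨ (g : Hq) * p = -(p * g) := by
  have h1 : Commute s ((↑g⁻¹ : Hq) * p * g) :=
    (commute_conj (u := g) (by simp [mul_assoc]) (by simp)).2 h
  have h2 := eq_or_eq_neg_of_commute hp (by simpa using mul_self_conj hp g⁻¹)
    ((hsp _).1 h1.symm).symm
  rw [mul_assoc, Units.inv_mul_eq_iff_eq_mul, Units.inv_mul_eq_iff_eq_mul, mul_neg] at h2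
  exact h2.imp Eq.symm fun h => by rw [h, neg_neg]

lemma index_axisStab {G : Subgroup Hqˣ} [Finite G] {p : Hq} {m : ℕ} (hm : 2 ≤ m)
    (hS : Nat.card ↥(G ⊓ axisStab p) = 2 * m) (hG : Nat.card G = 4 * m) :
    ((axisStab p).subgroupOf G).index = 2 := by
  have h := Subgroup.card_mul_index ((axisStab p).subgroupOf G)
  have h2 : Nat.card ((axisStab p).subgroupOf G) = 2 * m := by
    rw [← hS, inf_comm, ← Subgroup.subgroupOf_map_subtype,
      Subgroup.card_map_of_injective G.subtype_injective]
  rw [h2, hG] at h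
  have : 2 * m * ((axisStab p).subgroupOf G).index = 2 * m * 2 := by rw [h]; ring
  exact Nat.eq_of_mul_eq_mul_left (by omega) this

/-- A group with an axis whose stabilizer is of order `2m` and index two is binary dihedral. -/
lemma exists_conjSub_eq_binDihQ {G : Subgroup Hqˣ} [Finite G] {p : Hq} {m : ℕ} (hp : p * p = -1)
    (hm : 2 ≤ m) (hS : Nat.card ↥(G ⊓ axisStab p) = 2 * m) (hG : Nat.card G = 4 * m) :
    ∃ u : Hqˣ, conjSub u G = binDihQ m := by
  have hidx := index_axisStab hm hS hG
  obtain ⟨s, hsG, -, hsp⟩ := exists_generator_of_axis hp hm hS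
  obtain ⟨g, hg, hgp⟩ : ∃ g ∈ G, g ∉ axisStab p := by
    by_contra! hcon
    have : G ⊓ axisStab p = G := inf_eq_left.2 hcon
    rw [this] at hS
    omega
  have hgs : g * s * g⁻¹ ∈ axisStab p := by
    have hn := Subgroup.normal_of_index_eq_two hidx
    exact hn.conj_mem ⟨s, hsG⟩ ((hsp _).1 (Commute.refl _)) ⟨g, hg⟩
  have hgps : (g : Hq) * p = -(p * g) :=
    (mul_axis_of_commute_conj hp hsp (by simpa [mem_axisStab] using hgs)).resolve_left hgp
  have hre : ∀ x y : Hq, (x * y).re = (y * x).re := fun x y => by simp; ring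
  have hg0 : (g : Hq).re = 0 := by
    have h1 := hre p (g * p)
    have h2 : p * (g * p) = g := by rw [hgps, mul_neg, ← mul_assoc, hp]; simp
    rw [h2, mul_assoc, hp, mul_neg_one, Quaternion.re_neg] at h1
    linarith
  have hpg0 : (p * (g : Hq)).re = 0 := by
    have h1 := hre g p
    rw [hgps, Quaternion.re_neg] at h1
    linarith
  have hi1 := normSq_eq_one_of_mul_self iq_mul_self
  have hj1 := normSq_eq_one_of_mul_self jq_mul_self
  obtain ⟨u, hup, hug⟩ := exists_conj_pair (s := p) (t := g) (s' := iq) (t' := jq)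
    (normSq_eq_one_of_mul_self hp) (normSq_eq_one_of_mem hg) hi1 hj1
    (by rw [re_eq_zero_of_mul_self hp, re_eq_zero_of_mul_self iq_mul_self])
    (by rw [hg0, re_eq_zero_of_mul_self jq_mul_self])
    (by rw [hpg0]; simp [iq_eq_mkQ, jq_eq_mkQ]) (fun e => hgp e.symm)
  refine ⟨u, ?_⟩
  have hfin : Finite (conjSub u G) := Nat.finite_of_card_ne_zero (by
    rw [card_conjSub]; exact Nat.card_pos.ne')
  have : Finite ↥(G ⊓ axisStab p) := Nat.finite_of_card_ne_zero (by omega)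
  have hcyc : cycQ (2 * m) ≤ conjSub u G := by
    rw [← hS, ← conjSub_eq_cycQ inf_le_right hup]
    exact Subgroup.map_mono inf_le_left
  obtain ⟨j, hj⟩ : ∃ j : Hqˣ, (j : Hq) = jq :=
    ⟨Units.mk0 jq (ne_zero_of_mul_self jq_mul_self), rfl⟩
  have hjG : j ∈ conjSub u G := mem_conjSub_of_mul_eq hg (by rw [hj, hug])
  have hle : binDihQ m ≤ conjSub u G := by
    refine genQ_le fun v hv => ?_
    rcases hv with hv | hv
    · refine hcyc (mem_genQ ?_)
      rw [hv]; exact Set.mem_singleton _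
    · have : v = j := Units.ext (by rw [hj]; exact hv)
      rwa [this]
  have : Finite (binDihQ m) := Finite.of_injective _ (Subgroup.inclusion_injective hle)
  have hlt : cycQ (2 * m) < binDihQ m := by
    refine lt_of_le_not_ge (genQ_mono (by simp)) fun hle' => ?_
    have h1 : j ∈ cycQ (2 * m) := hle' (mem_genQ (by simp [hj]))
    rw [← hS, ← conjSub_eq_cycQ inf_le_right hup, conjSub_inf_axisStab hup] at h1
    have h2 := congrArg QuaternionAlgebra.imK (mem_axisStab.1 h1.2).eq
    rw [hj] at h2
    norm_num [iq_eq_mkQ, jq_eq_mkQ] at h2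
  have hcard := two_mul_card_le_of_lt hlt
  rw [card_cycQ (by omega)] at hcard
  refine (Subgroup.eq_of_le_of_card_ge hle ?_).symm
  rw [card_conjSub, hG]
  omega

/-- A group with more than `4m` elements and an axis whose stabilizer has order `2m` contains two
conjugate noncommuting rotations by `2π/m`. -/
lemma exists_noncommuting_generators {G : Subgroup Hqˣ} [Finite G] {p : Hq} {m : ℕ}
    (hp : p * p = -1) (hm : 2 ≤ m) (hS : Nat.card ↥(G ⊓ axisStab p) = 2 * m)
    (hG : 4 * m < Nat.card G) :
    ∃ s ∈ G, ∃ t ∈ G, (s : Hq).re = Real.cos (Real.pi / m) ∧ (t : Hq).re = (s : Hq).re ∧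
      (s : Hq) * t ≠ t * s := by
  obtain ⟨s, hsG, hs, hsp⟩ := exists_generator_of_axis hp hm hS
  have hS' : Nat.card ((axisStab p).subgroupOf G) = 2 * m := by
    rw [← hS, inf_comm, ← Subgroup.subgroupOf_map_subtype,
      Subgroup.card_map_of_injective G.subtype_injective]
  obtain ⟨g, hg, hgp, hgp'⟩ : ∃ g ∈ G, (g : Hq) * p ≠ p * g ∧ (g : Hq) * p ≠ -(p * g) := by
    by_contra! hcon
    obtain ⟨g, hg, hgp⟩ : ∃ g ∈ G, g ∉ axisStab p := by
      by_contra! hcon'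
      have : G ⊓ axisStab p = G := inf_eq_left.2 hcon'
      rw [this] at hS
      omega
    have hidx : ((axisStab p).subgroupOf G).index = 2 := by
      rw [Subgroup.index_eq_two_iff]
      refine ⟨⟨g, hg⟩, fun ⟨b, hb⟩ => ?_⟩
      simp only [Subgroup.mem_subgroupOf, Subgroup.coe_mul, mem_axisStab, Units.val_mul]
      by_cases hbp : Commute (b : Hq) p
      · refine Or.inr ⟨hbp, fun h => hgp ?_⟩
        have := (hbp.units_inv_left).mul_left h
        rwa [Units.inv_mul_cancel_left] at this
      · refine Or.inl ⟨?_, hbp⟩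
        change _ * _ = _ * _
        rw [mul_assoc, hcon g hg hgp, mul_neg, ← mul_assoc, hcon b hb hbp, neg_mul, neg_neg,
          mul_assoc]
    have h := Subgroup.card_mul_index ((axisStab p).subgroupOf G)
    rw [hidx, hS'] at h
    omega
  refine ⟨s, hsG, g * s * g⁻¹, mul_mem (mul_mem hg hsG) (inv_mem hg), hs, ?_, fun h => ?_⟩
  · rw [Units.val_mul, Units.val_mul, re_conj]
  · have := (hsp _).1 (show Commute _ _ from h.symm)
    exact (mul_axis_of_commute_conj hp hsp (by simpa using this)).elim hgp hgp'

lemma re_mul_inv {s t : Hqˣ} (ht : Quaternion.normSq (t : Hq) = 1) :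
    ((s : Hq) * (↑t⁻¹ : Hq)).re = 2 * (s : Hq).re * (t : Hq).re - ((s : Hq) * t).re := by
  rw [val_inv_eq_star ht]
  simp
  ring

lemma re_mul_lt_one {s t : Hqˣ} (hs : Quaternion.normSq (s : Hq) = 1)
    (ht : Quaternion.normSq (t : Hq) = 1) (h : (s : Hq) * t ≠ t * s) : ((s : Hq) * t).re < 1 := by
  have hn : Quaternion.normSq ((s : Hq) * (t : Hq)) = 1 := by rw [map_mul, hs, ht, one_mul]
  refine lt_of_le_of_ne (re_le_one hn) fun e => h ?_
  have h1 := eq_one_of_re hn e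
  have h2 : s * t = 1 := Units.ext h1
  rw [h1, ← Units.val_mul, mul_eq_one_iff_eq_inv.1 h2]
  simp

lemma mul_inv_ne_inv_mul {s t : Hqˣ} (h : (s : Hq) * t ≠ t * s) :
    (s : Hq) * (↑t⁻¹ : Hq) ≠ (↑t⁻¹ : Hq) * s := fun e =>
  h (by simpa using (Commute.units_inv_right (show Commute (s : Hq) (↑t⁻¹ : Hq) from e)).eq)

/-- Conjugating a noncommuting pair onto a pair with the same traces. -/
lemma exists_mem_conjSub {G : Subgroup Hqˣ} [Finite G] {s t s' t' : Hqˣ} (hs : s ∈ G) (ht : t ∈ G)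
    (hs' : Quaternion.normSq (s' : Hq) = 1) (ht' : Quaternion.normSq (t' : Hq) = 1)
    (hres : (s : Hq).re = (s' : Hq).re) (hret : (t : Hq).re = (t' : Hq).re)
    (hst : ((s : Hq) * t).re = ((s' : Hq) * t').re) (hc : (s : Hq) * t ≠ t * s) :
    ∃ u : Hqˣ, s' ∈ conjSub u G ∧ t' ∈ conjSub u G := by
  obtain ⟨u, h1, h2⟩ := exists_conj_pair (normSq_eq_one_of_mem hs) (normSq_eq_one_of_mem ht)
    hs' ht' hres hret hst hc
  exact ⟨u, mem_conjSub_of_mul_eq hs h1, mem_conjSub_of_mul_eq ht h2⟩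

/-- A finite group containing two elements with noncommuting squares is of polyhedral type. -/
lemma polyhedral_of_noncommuting_squares {K : Subgroup Hqˣ} [Finite K] {x y : Hqˣ} (hx : x ∈ K)
    (hy : y ∈ K) (h : ¬ Commute ((x : Hq) * x) ((y : Hq) * y)) :
    ∃ m, (m = 3 ∧ Nat.card K = 24 ∨ m = 4 ∧ Nat.card K = 48 ∨ m = 5 ∧ Nat.card K = 120) ∧
      ∀ g ∈ K, (g : Hq) ^ 4 = 1 ∨ (g : Hq) ^ 6 = 1 ∨ (g : Hq) ^ (2 * m) = 1 := by
  rcases axis_trichotomy K with ⟨p, hp, hK⟩ | ⟨p, m, hp, hm, hS, hK⟩ | ⟨p, m, -, -, h1, h2⟩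
  · exact absurd (commute_of_commute_axis hp (hK (mul_mem hx hx)) (hK (mul_mem hy hy))) h
  · have hidx := index_axisStab hm hS hK
    have hsq : ∀ g ∈ K, g * g ∈ axisStab p := fun g hg =>
      Subgroup.mul_self_mem_of_index_two hidx ⟨g, hg⟩
    exact absurd (commute_of_commute_axis hp (hsq x hx) (hsq y hy)) h
  · exact ⟨m, h1, h2⟩

/-- A quaternion of norm one as a unit. -/
def unitOf (q : Hq) (h : Quaternion.normSq q = 1) : Hqˣ :=
  Units.mk0 q (by rintro rfl; simp at h)

@[simp] lemma coe_unitOf (q : Hq) (h : Quaternion.normSq q = 1) : (unitOf q h : Hq) = q := rfl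

lemma normSq_mkQ (a b c d : ℝ) :
    Quaternion.normSq (mkQ a b c d) = a ^ 2 + b ^ 2 + c ^ 2 + d ^ 2 := by
  rw [Quaternion.normSq_def']
  rfl

lemma mem_of_val_mem {K : Subgroup Hqˣ} {x v : Hqˣ} (hx : x ∈ K) (h : (v : Hq) = x) : v ∈ K :=
  Units.ext h ▸ hx

lemma mem_mul_of_val_eq {K : Subgroup Hqˣ} {x y v : Hqˣ} (hx : x ∈ K) (hy : y ∈ K)
    (h : (x : Hq) * y = v) : v ∈ K :=
  mem_of_val_mem (mul_mem hx hy) (by rw [Units.val_mul, h])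

lemma exists_conjSub_eq_binTetQ {G : Subgroup Hqˣ} [Finite G] {p : Hq} (hp : p * p = -1)
    (hS : Nat.card ↥(G ⊓ axisStab p) = 2 * 3) (hG : Nat.card G = 24)
    (hpow : ∀ g ∈ G, (g : Hq) ^ 4 = 1 ∨ (g : Hq) ^ 6 = 1 ∨ (g : Hq) ^ (2 * 3) = 1) :
    ∃ u : Hqˣ, conjSub u G = binTetQ := by
  have hR : ∀ g ∈ G, (g : Hq).re = 0 ∨ (g : Hq).re = 1 ∨ (g : Hq).re = -1 ∨
      (g : Hq).re = 1 / 2 ∨ (g : Hq).re = -1 / 2 := by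
    intro g hg
    have hn := normSq_eq_one_of_mem hg
    rcases hpow g hg with h | h | h
    · have := re_of_pow_four hn h; tauto
    all_goals have := re_of_pow_six hn h; tauto
  obtain ⟨s, hs, t, ht, hsre, htre, hc⟩ := exists_noncommuting_generators hp (by norm_num) hS
    (by rw [hG]; norm_num)
  have hns := normSq_eq_one_of_mem hs
  have hnt := normSq_eq_one_of_mem ht
  rw [Nat.cast_ofNat, Real.cos_pi_div_three] at hsre
  rw [hsre] at htre
  have h1 := re_mul_lt_one hns hnt hc
  have h2 := re_mul_lt_one hns (normSq_eq_one_of_mem (inv_mem ht)) (mul_inv_ne_inv_mul hc)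
  have h3 := re_mul_inv (s := s) hnt
  have h4 := hR _ (mul_mem hs ht)
  rw [h3, hsre, htre] at h2
  rw [hsre, htre] at h3
  rw [Units.val_mul] at h4
  have hsu : Quaternion.normSq ωq = 1 := by rw [ωq_eq_mkQ, normSq_mkQ]; norm_num
  have htu : Quaternion.normSq (mkQ (1 / 2) (1 / 2) (1 / 2) (-1 / 2)) = 1 := by
    rw [normSq_mkQ]; norm_num
  obtain ⟨t', ht', htre', hst', hc'⟩ : ∃ t' ∈ G, (t' : Hq).re = 1 / 2 ∧ ((s : Hq) * t').re = 0 ∧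
      (s : Hq) * t' ≠ t' * s := by
    have : ((s : Hq) * t).re = 0 ∨ ((s : Hq) * t).re = 1 / 2 := by
      rcases h4 with h | h | h | h | h
      · exact Or.inl h
      · linarith
      · linarith
      · exact Or.inr h
      · linarith
    rcases this with h | h
    · exact ⟨t, ht, htre, h, hc⟩
    · refine ⟨t⁻¹, inv_mem ht, ?_, by rw [h3, h]; norm_num, mul_inv_ne_inv_mul hc⟩
      rw [val_inv_eq_star hnt, Quaternion.re_star, htre]
  obtain ⟨u, hsG, htG⟩ := exists_mem_conjSub (s' := unitOf _ hsu) (t' := unitOf _ htu) hs ht' hsu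
    htu (by rw [hsre]; rfl) (by rw [htre']; rfl)
    (by rw [hst']; norm_num [ωq_eq_mkQ]) hc'
  refine ⟨u, ?_⟩
  have hle : binTetQ ≤ conjSub u G := by
    refine genQ_le fun v hv => ?_
    rcases hv with hv | hv | hv
    · refine mem_mul_of_val_eq htG hsG ?_
      rw [hv]
      ext <;> norm_num [ωq_eq_mkQ, iq_eq_mkQ]
    · refine mem_mul_of_val_eq hsG htG ?_
      rw [hv]
      ext <;> norm_num [ωq_eq_mkQ, jq_eq_mkQ]
    · exact mem_of_val_mem hsG hv
  have hfin' : Finite (conjSub u G) := Nat.finite_of_card_ne_zero (by rw [card_conjSub, hG]; simp)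
  have : Finite binTetQ := Finite.of_injective _ (Subgroup.inclusion_injective hle)
  obtain ⟨j, hj⟩ : ∃ j : Hqˣ, (j : Hq) = jq :=
    ⟨Units.mk0 jq (ne_zero_of_mul_self jq_mul_self), rfl⟩
  have hsK : unitOf _ hsu ∈ binTetQ := mem_genQ (by simp)
  have htK : unitOf _ htu ∈ binTetQ := by
    have hjK : j ∈ binTetQ := mem_genQ (by simp [hj])
    refine mem_mul_of_val_eq (inv_mem hsK) hjK ?_
    rw [Units.inv_mul_eq_iff_eq_mul, hj]
    ext <;> norm_num [ωq_eq_mkQ, jq_eq_mkQ]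
  obtain ⟨m, hm, -⟩ := polyhedral_of_noncommuting_squares hsK htK (by
    intro h
    have := congrArg QuaternionAlgebra.imI h.eq
    norm_num [ωq_eq_mkQ] at this)
  refine (Subgroup.eq_of_le_of_card_ge hle ?_).symm
  rw [card_conjSub, hG]
  omega

lemma exists_conjSub_eq_binOctQ {G : Subgroup Hqˣ} [Finite G] {p : Hq} (hp : p * p = -1)
    (hS : Nat.card ↥(G ⊓ axisStab p) = 2 * 4) (hG : Nat.card G = 48)
    (hpow : ∀ g ∈ G, (g : Hq) ^ 4 = 1 ∨ (g : Hq) ^ 6 = 1 ∨ (g : Hq) ^ (2 * 4) = 1) :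
    ∃ u : Hqˣ, conjSub u G = binOctQ := by
  have hR : ∀ g ∈ G, (g : Hq).re = 0 ∨ (g : Hq).re = 1 ∨ (g : Hq).re = -1 ∨
      (g : Hq).re = 1 / 2 ∨ (g : Hq).re = -1 / 2 ∨ (g : Hq).re = √2 / 2 ∨
      (g : Hq).re = -√2 / 2 := by
    intro g hg
    have hn := normSq_eq_one_of_mem hg
    rcases hpow g hg with h | h | h
    · have := re_of_pow_four hn h; tauto
    · have := re_of_pow_six hn h; tauto
    · have := re_of_pow_eight hn h; tauto
  have hsq : √2 * √2 = 2 := by simp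
  have hsq' : 1.4 < √2 := Real.lt_sqrt_of_sq_lt (by norm_num)
  have hsq'' : √2 < 1.5 := (Real.sqrt_lt' (by norm_num)).2 (by norm_num)
  obtain ⟨s, hs, t, ht, hsre, htre, hc⟩ := exists_noncommuting_generators hp (by norm_num) hS
    (by rw [hG]; norm_num)
  have hns := normSq_eq_one_of_mem hs
  have hnt := normSq_eq_one_of_mem ht
  rw [Nat.cast_ofNat, Real.cos_pi_div_four] at hsre
  rw [hsre] at htre
  have h1 := re_mul_lt_one hns hnt hc
  have h2 := re_mul_lt_one hns (normSq_eq_one_of_mem (inv_mem ht)) (mul_inv_ne_inv_mul hc)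
  have h3 := re_mul_inv (s := s) hnt
  have h4 := hR _ (mul_mem hs ht)
  have h5 := hR _ (mul_mem hs (inv_mem ht))
  have hcc : 2 * (√2 / 2) * (√2 / 2) = 1 := by linarith
  rw [hsre, htre, hcc] at h3
  rw [h3] at h2
  rw [Units.val_mul] at h4
  rw [Units.val_mul, h3] at h5
  have hst : ((s : Hq) * t).re = 1 / 2 := by
    rcases h4 with h | h | h | h | h | h | h
    · linarith
    · linarith
    · linarith
    · exact h
    · linarith
    · rcases h5 with h' | h' | h' | h' | h' | h' | h' <;> linarith
    · linarith
  have hsu : Quaternion.normSq sqq = 1 := by rw [sqq_eq_mkQ, normSq_mkQ]; ring_nf; norm_num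
  have htu : Quaternion.normSq (mkQ (√2 / 2) 0 (√2 / 2) 0) = 1 := by
    rw [normSq_mkQ]; ring_nf; norm_num
  obtain ⟨u, hsG, htG⟩ := exists_mem_conjSub (s' := unitOf _ hsu) (t' := unitOf _ htu) hs ht hsu
    htu (by rw [hsre]; rfl) (by rw [htre]; rfl)
    (by rw [hst]; simp [sqq_eq_mkQ]; linarith) hc
  refine ⟨u, ?_⟩
  have hst' : sqq * mkQ (√2 / 2) 0 (√2 / 2) 0 = ωq := by
    ext <;> simp [ωq_eq_mkQ, sqq_eq_mkQ] <;> linarith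
  have hss : sqq * sqq = iq := by
    ext <;> simp [iq_eq_mkQ, sqq_eq_mkQ]
    linarith
  have htt : mkQ (√2 / 2) 0 (√2 / 2) 0 * mkQ (√2 / 2) 0 (√2 / 2) 0 = jq := by
    ext <;> simp [jq_eq_mkQ]
    linarith
  have hle : binOctQ ≤ conjSub u G := by
    refine genQ_le fun v hv => ?_
    rcases hv with hv | hv | hv | hv
    · exact mem_mul_of_val_eq hsG hsG (by rw [hv]; exact hss)
    · exact mem_mul_of_val_eq htG htG (by rw [hv]; exact htt)
    · exact mem_mul_of_val_eq hsG htG (by rw [hv]; exact hst')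
    · exact mem_of_val_mem hsG hv
  have hfin' : Finite (conjSub u G) := Nat.finite_of_card_ne_zero (by rw [card_conjSub, hG]; simp)
  have : Finite binOctQ := Finite.of_injective _ (Subgroup.inclusion_injective hle)
  have hsK : unitOf _ hsu ∈ binOctQ := mem_genQ (by simp)
  have htK : unitOf _ htu ∈ binOctQ := by
    obtain ⟨w, hw⟩ : ∃ w : Hqˣ, (w : Hq) = ωq :=
      ⟨unitOf _ hsu * unitOf _ htu, hst'⟩
    have hwK : w ∈ binOctQ := mem_genQ (by simp [hw])
    refine mem_mul_of_val_eq (inv_mem hsK) hwK ?_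
    rw [Units.inv_mul_eq_iff_eq_mul, hw]
    exact hst'.symm
  obtain ⟨m, hm, hmpow⟩ := polyhedral_of_noncommuting_squares hsK htK (by
    rw [coe_unitOf, coe_unitOf, hss, htt]
    intro h
    have := congrArg QuaternionAlgebra.imK h.eq
    norm_num [iq_eq_mkQ, jq_eq_mkQ] at this)
  refine (Subgroup.eq_of_le_of_card_ge hle ?_).symm
  have h24 : m ≠ 3 := by
    rintro rfl
    have hre : sqq.re = √2 / 2 := rfl
    rcases hmpow _ hsK with h | h | h
    · have := re_of_pow_four hsu h
      rw [hre] at this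
      rcases this with h | h | h <;> linarith
    all_goals
      have := re_of_pow_six hsu h
      rw [hre] at this
      rcases this with h | h | h | h <;> linarith
  rw [card_conjSub, hG]
  omega

lemma exists_conjSub_eq_binIcoQ {G : Subgroup Hqˣ} [Finite G] {p : Hq} (hp : p * p = -1)
    (hS : Nat.card ↥(G ⊓ axisStab p) = 2 * 5) (hG : Nat.card G = 120)
    (hpow : ∀ g ∈ G, (g : Hq) ^ 4 = 1 ∨ (g : Hq) ^ 6 = 1 ∨ (g : Hq) ^ (2 * 5) = 1) :
    ∃ u : Hqˣ, conjSub u G = binIcoQ := by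
  have hR : ∀ g ∈ G, (g : Hq).re = 0 ∨ (g : Hq).re = 1 ∨ (g : Hq).re = -1 ∨
      (g : Hq).re = 1 / 2 ∨ (g : Hq).re = -1 / 2 ∨ (g : Hq).re = φg / 2 ∨
      (g : Hq).re = -φg / 2 ∨ (g : Hq).re = (φg - 1) / 2 ∨ (g : Hq).re = (1 - φg) / 2 := by
    intro g hg
    have hn := normSq_eq_one_of_mem hg
    rcases hpow g hg with h | h | h
    · have := re_of_pow_four hn h; tauto
    · have := re_of_pow_six hn h; tauto
    · have := re_of_pow_ten hn h; tauto
  have hφ := φg_sq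
  obtain ⟨hφ1, hφ2⟩ := φg_bounds
  obtain ⟨s, hs, t, ht, hsre, htre, hc⟩ := exists_noncommuting_generators hp (by norm_num) hS
    (by rw [hG]; norm_num)
  have hns := normSq_eq_one_of_mem hs
  have hnt := normSq_eq_one_of_mem ht
  have hcos : Real.cos (Real.pi / 5) = φg / 2 := by rw [Real.cos_pi_div_five, φg]; ring
  rw [Nat.cast_ofNat, hcos] at hsre
  rw [hsre] at htre
  have h1 := re_mul_lt_one hns hnt hc
  have h2 := re_mul_lt_one hns (normSq_eq_one_of_mem (inv_mem ht)) (mul_inv_ne_inv_mul hc)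
  have h3 := re_mul_inv (s := s) hnt
  have h4 := hR _ (mul_mem hs ht)
  have hcc : 2 * (φg / 2) * (φg / 2) = (φg + 1) / 2 := by linarith
  rw [hsre, htre, hcc] at h3
  rw [h3] at h2
  rw [Units.val_mul] at h4
  have hsu : Quaternion.normSq τq = 1 := by rw [τq_eq_mkQ, normSq_mkQ]; linarith
  have htu : Quaternion.normSq (mkQ (φg / 2) 0 ((φg - 1) / 2) (1 / 2)) = 1 := by
    rw [normSq_mkQ]; linarith
  obtain ⟨t', ht', htre', hst', hc'⟩ : ∃ t' ∈ G, (t' : Hq).re = φg / 2 ∧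
      ((s : Hq) * t').re = 1 / 2 ∧ (s : Hq) * t' ≠ t' * s := by
    have : ((s : Hq) * t).re = 1 / 2 ∨ ((s : Hq) * t).re = φg / 2 := by
      rcases h4 with h | h | h | h | h | h | h | h | h
      · linarith
      · linarith
      · linarith
      · exact Or.inl h
      · linarith
      · exact Or.inr h
      all_goals linarith
    rcases this with h | h
    · exact ⟨t, ht, htre, h, hc⟩
    · refine ⟨t⁻¹, inv_mem ht, ?_, by rw [h3, h]; ring, mul_inv_ne_inv_mul hc⟩
      rw [val_inv_eq_star hnt, Quaternion.re_star, htre]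
  have hst : τq * mkQ (φg / 2) 0 ((φg - 1) / 2) (1 / 2) = ωq := by
    ext <;> simp [ωq_eq_mkQ, τq_eq_mkQ] <;> linarith
  obtain ⟨u, hsG, htG⟩ := exists_mem_conjSub (s' := unitOf _ hsu) (t' := unitOf _ htu) hs ht' hsu
    htu (by rw [hsre]; rfl) (by rw [htre']; rfl)
    (by rw [hst', coe_unitOf, coe_unitOf, hst]; rfl) hc'
  refine ⟨u, ?_⟩
  have hle : binIcoQ ≤ conjSub u G := by
    refine genQ_le fun v hv => ?_
    rcases hv with hv | hv
    · exact mem_mul_of_val_eq hsG htG (by rw [hv]; exact hst)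
    · exact mem_of_val_mem hsG hv
  have hfin' : Finite (conjSub u G) := Nat.finite_of_card_ne_zero (by rw [card_conjSub, hG]; simp)
  have : Finite binIcoQ := Finite.of_injective _ (Subgroup.inclusion_injective hle)
  have hsK : unitOf _ hsu ∈ binIcoQ := mem_genQ (by simp)
  have htK : unitOf _ htu ∈ binIcoQ := by
    obtain ⟨w, hw⟩ : ∃ w : Hqˣ, (w : Hq) = ωq := ⟨unitOf _ hsu * unitOf _ htu, hst⟩
    have hwK : w ∈ binIcoQ := mem_genQ (by simp [hw])
    refine mem_mul_of_val_eq (inv_mem hsK) hwK ?_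
    rw [Units.inv_mul_eq_iff_eq_mul, hw]
    exact hst.symm
  obtain ⟨m, hm, hmpow⟩ := polyhedral_of_noncommuting_squares hsK htK (by
    intro h
    have h1 : τq * τq = mkQ ((φg - 1) / 2) (1 / 2) (φg / 2) 0 := by
      ext <;> simp [τq_eq_mkQ] <;> linarith
    have h2 : mkQ (φg / 2) 0 ((φg - 1) / 2) (1 / 2) * mkQ (φg / 2) 0 ((φg - 1) / 2) (1 / 2) =
        mkQ ((φg - 1) / 2) 0 (1 / 2) (φg / 2) := by
      ext <;> simp <;> linarith
    rw [coe_unitOf, coe_unitOf, h1, h2] at h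
    have := congrArg QuaternionAlgebra.imK h.eq
    simp at this
    linarith)
  refine (Subgroup.eq_of_le_of_card_ge hle ?_).symm
  have h24 : m ≠ 3 := by
    rintro rfl
    have hre : τq.re = φg / 2 := rfl
    rcases hmpow _ hsK with h | h | h
    · have := re_of_pow_four hsu h
      rw [hre] at this
      rcases this with h | h | h <;> linarith
    all_goals
      have := re_of_pow_six hsu h
      rw [hre] at this
      rcases this with h | h | h | h <;> linarith
  have hdvd : Nat.card binIcoQ ∣ 120 := by
    have := Subgroup.card_dvd_of_le hle
    rwa [card_conjSub, hG] at this
  rw [card_conjSub, hG]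
  rcases hm with h | h | h
  · omega
  · rw [h.2] at hdvd; omega
  · omega

/-- every finite subgroup of `ℍ^×` is conjugate to a cyclic group `C_d` (`d ≥ 1`),
a binary dihedral group of order `4d` (`d ≥ 2`), or the binary tetrahedral, binary octahedral
or binary icosahedral group, of orders 24, 48, 120 respectively. -/
theorem stmt9 (G : Subgroup Hqˣ) (hG : Finite ↥G) :
    ∃ u : Hqˣ,
      (∃ d : ℕ, 1 ≤ d ∧ Subgroup.map (MulAut.conj u).toMonoidHom G = cycQ d ∧
        Nat.card ↥(cycQ d) = d) ∨
      (∃ d : ℕ, 2 ≤ d ∧ Subgroup.map (MulAut.conj u).toMonoidHom G = binDihQ d ∧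
        Nat.card ↥(binDihQ d) = 4 * d) ∨
      (Subgroup.map (MulAut.conj u).toMonoidHom G = binTetQ ∧ Nat.card ↥binTetQ = 24) ∨
      (Subgroup.map (MulAut.conj u).toMonoidHom G = binOctQ ∧ Nat.card ↥binOctQ = 48) ∨
      (Subgroup.map (MulAut.conj u).toMonoidHom G = binIcoQ ∧ Nat.card ↥binIcoQ = 120) := by
  rcases axis_trichotomy G with ⟨p, hp, hGp⟩ | ⟨p, m, hp, hm, hS, hcard⟩ | ⟨p, m, hp, hS, hm, hpow⟩
  · obtain ⟨u, hu⟩ := exists_conj_axis hp iq_mul_self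
    exact ⟨u, Or.inl ⟨Nat.card G, Nat.card_pos, conjSub_eq_cycQ hGp hu,
      card_cycQ Nat.card_pos.ne'⟩⟩
  · obtain ⟨u, hu⟩ := exists_conjSub_eq_binDihQ hp hm hS hcard
    exact ⟨u, Or.inr (Or.inl ⟨m, hm, hu, by rw [← hu, card_conjSub, hcard]⟩)⟩
  · rcases hm with ⟨rfl, hcard⟩ | ⟨rfl, hcard⟩ | ⟨rfl, hcard⟩
    · obtain ⟨u, hu⟩ := exists_conjSub_eq_binTetQ hp hS hcard hpow
      exact ⟨u, Or.inr (Or.inr (Or.inl ⟨hu, by rw [← hu, card_conjSub, hcard]⟩))⟩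
    · obtain ⟨u, hu⟩ := exists_conjSub_eq_binOctQ hp hS hcard hpow
      exact ⟨u, Or.inr (Or.inr (Or.inr (Or.inl ⟨hu, by rw [← hu, card_conjSub, hcard]⟩)))⟩
    · obtain ⟨u, hu⟩ := exists_conjSub_eq_binIcoQ hp hS hcard hpow
      exact ⟨u, Or.inr (Or.inr (Or.inr (Or.inr ⟨hu, by rw [← hu, card_conjSub, hcard]⟩)))⟩
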